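/- arXiv:2402.16396 — 3 statements merged into one kernel-verified Lean document; each statement's English description precedes it below -/
import Mathlib

section
/- For the function L(x) = √|x| on ℝ, there exist constants ε ∈ (0,1) and C(ε) > 1 such that for all real x ≠ 0 and all real y, L(x+y) − L(x) ≤ √|x| · ( y/(2x) − y²/(10x²) + C(ε)·y²·1_{|y| > ε|x|}/x² ). -/
theorem stmt0 :
    ∃ ε ∈ Set.Ioo (0:ℝ) 1, ∃ C : ℝ, 1 < C ∧
      ∀ x y : ℝ, x ≠ 0 →
        Real.sqrt |x + y| - Real.sqrt |x| ≤
          Real.sqrt |x| *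
            (y / (2 * x) - y ^ 2 / (10 * x ^ 2) +
              C * y ^ 2 * (if ε * |x| < |y| then (1:ℝ) else 0) / x ^ 2) := by
  refine ⟨1/4, by norm_num, 5, by norm_num, ?_⟩
  intro x y hx
  obtain ⟨t, rfl⟩ : ∃ t, y = x * t := ⟨y / x, by field_simp⟩
  have hx' : 0 < |x| := abs_pos.mpr hx
  have e1 : Real.sqrt |x + x * t| = Real.sqrt |x| * Real.sqrt |1 + t| := by
    rw [← Real.sqrt_mul (abs_nonneg x), ← abs_mul]
    congr 2
    ring
  have e2 : (1/4 * |x| < |x * t|) ↔ 1/4 < |t| := by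
    rw [abs_mul, mul_comm |x| |t|]
    exact mul_lt_mul_iff_left₀ hx'
  rw [e1]
  simp only [e2]
  have e3 : ∀ c : ℝ, x * t / (2 * x) - (x * t) ^ 2 / (10 * x ^ 2) + 5 * (x * t) ^ 2 * c / x ^ 2
      = t / 2 - t ^ 2 / 10 + 5 * t ^ 2 * c := by
    intro c
    field_simp
  rw [e3]
  have key : Real.sqrt |1 + t| - 1 ≤
      t / 2 - t ^ 2 / 10 + 5 * t ^ 2 * (if 1/4 < |t| then (1:ℝ) else 0) := by
    split_ifs with h
    · have h1 : Real.sqrt |1 + t| ≤ 1 + |t| / 2 := by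
        rw [Real.sqrt_le_left (by positivity)]
        have := abs_add_le 1 t
        rw [abs_one] at this
        nlinarith [sq_nonneg |t|]
      have h2 := neg_abs_le t
      have h3 := sq_abs t
      nlinarith
    · obtain ⟨ha, hb⟩ := abs_le.mp (not_lt.mp h)
      have h1 : Real.sqrt |1 + t| ≤ 1 + t / 2 - t ^ 2 / 10 := by
        rw [abs_of_nonneg (by linarith), Real.sqrt_le_left (by nlinarith)]
        have : 0 ≤ t ^ 2 * (1 / 20 - t / 10 + t ^ 2 / 100) :=
          mul_nonneg (sq_nonneg t) (by nlinarith [sq_nonneg t])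
        nlinarith
      linarith
  have := mul_le_mul_of_nonneg_left key (Real.sqrt_nonneg |x|)
  linarith
end

section
/- Let S be a step-reinforced random walk in ℝ^d with parameter α ≤ 1/2 and step distribution μ such that E|h(X₁)|^s < ∞ for some s ∈ (1,2), where h : ℝ^d → ℝ is measurable, and EX₁ = 0. Then for any ν ∈ (0, 1 − 1/s), n^ν Δₙ(h) → 0 almost surely and in L¹, where Δₙ(h) = (1/n)Σ_{i=1}^n h(Xᵢ) − Eh(X₁). -/
open MeasureTheory ProbabilityTheory Filter
open scoped ENNReal Topology

noncomputable section

/-- The natural filtration generated by the steps `X 1, …, X n`. -/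
def srrwFiltration {Ω E : Type*} [MeasurableSpace Ω] [MeasurableSpace E]
    (X : ℕ → Ω → E) (n : ℕ) : MeasurableSpace Ω :=
  ⨆ i ∈ Finset.Icc 1 n, MeasurableSpace.comap (X i) inferInstance

/-- A step-reinforced random walk with reinforcement parameter `α` and step
distribution `μ`: `X 1 ∼ μ`, and given the first `n` steps, the conditional law of
`X (n+1)` is `α · (empirical measure of X 1, …, X n) + (1-α) · μ`. -/
structure IsSRRW {Ω E : Type*} [MeasurableSpace Ω] [MeasurableSpace E]
    (P : Measure Ω) (α : ℝ) (μ : Measure E) (X : ℕ → Ω → E) : Prop where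
  probP : IsProbabilityMeasure P
  probμ : IsProbabilityMeasure μ
  alpha_nonneg : 0 ≤ α
  alpha_lt_one : α < 1
  meas : ∀ n, Measurable (X n)
  law_one : P.map (X 1) = μ
  cond : ∀ n : ℕ, 1 ≤ n → ∀ A : Set E, MeasurableSet A →
    (P[(fun ω => A.indicator (fun _ => (1:ℝ)) (X (n+1) ω)) | srrwFiltration X n])
      =ᵐ[P] fun ω =>
        (α / n) * ∑ i ∈ Finset.Icc 1 n, A.indicator (fun _ => (1:ℝ)) (X i ω)
        + (1 - α) * (μ A).toReal

/-- Position of the walk: `S n = X 1 + ⋯ + X n`, `S 0 = 0`. -/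
def srrwSum {Ω E : Type*} [AddCommMonoid E] (X : ℕ → Ω → E) (n : ℕ) (ω : Ω) : E :=
  ∑ i ∈ Finset.Icc 1 n, X i ω


namespace SRRWAux

lemma filt_le {Ω E : Type*} [m0 : MeasurableSpace Ω] [MeasurableSpace E]
    {X : ℕ → Ω → E} (hX : ∀ n, Measurable (X n)) (n : ℕ) : srrwFiltration X n ≤ m0 :=
  iSup₂_le fun i _ => (hX i).comap_le

lemma filt_mono {Ω E : Type*} [MeasurableSpace Ω] [MeasurableSpace E]
    (X : ℕ → Ω → E) {n k : ℕ} (h : n ≤ k) : srrwFiltration X n ≤ srrwFiltration X k := by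
  refine iSup₂_le fun i hi => ?_
  have hi' : i ∈ Finset.Icc 1 k := by
    simp only [Finset.mem_Icc] at hi ⊢; omega
  exact le_iSup₂ (f := fun i (_ : i ∈ Finset.Icc 1 k) =>
    MeasurableSpace.comap (X i) inferInstance) i hi'

lemma meas_filt {Ω E : Type*} [MeasurableSpace Ω] [MeasurableSpace E]
    (X : ℕ → Ω → E) {i n : ℕ} (h : i ∈ Finset.Icc 1 n) : Measurable[srrwFiltration X n] (X i) := by
  refine Measurable.mono (comap_measurable (X i)) ?_ le_rfl
  exact le_iSup₂ (f := fun i (_ : i ∈ Finset.Icc 1 n) =>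
    MeasurableSpace.comap (X i) inferInstance) i h

variable {Ω E : Type*} [m0 : MeasurableSpace Ω] [MeasurableSpace E]
    {P : Measure Ω} {α : ℝ} {μ : Measure E} {X : ℕ → Ω → E}

lemma map_restrict (hS : IsSRRW P α μ X) {n : ℕ} (hn : 1 ≤ n) {B : Set Ω}
    (hB : MeasurableSet[srrwFiltration X n] B) :
    (P.restrict B).map (X (n+1)) =
      ENNReal.ofReal (α / n) • (∑ i ∈ Finset.Icc 1 n, (P.restrict B).map (X i))
        + (ENNReal.ofReal (1 - α) * P B) • μ := by
  have := hS.probP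
  have := hS.probμ
  have hle := filt_le hS.meas n
  have hαn : 0 ≤ α / n := div_nonneg hS.alpha_nonneg (Nat.cast_nonneg n)
  have h1α : 0 ≤ 1 - α := by linarith [hS.alpha_lt_one]
  have key : ∀ (i : ℕ) (A : Set E), MeasurableSet A →
      ∫ ω in B, A.indicator (fun _ => (1:ℝ)) (X i ω) ∂P = ((P.restrict B).map (X i) A).toReal := by
    intro i A hA
    have : (fun ω => A.indicator (fun _ => (1:ℝ)) (X i ω))
        = (X i ⁻¹' A).indicator (fun _ => (1:ℝ)) := by
      ext ω; by_cases hω : X i ω ∈ A <;> simp [Set.indicator, hω]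
    rw [this, integral_indicator (hS.meas i hA), Measure.map_apply (hS.meas i) hA]
    simp [Measure.real]
  have intg : ∀ (i : ℕ) (A : Set E), MeasurableSet A →
      Integrable (fun ω => A.indicator (fun _ => (1:ℝ)) (X i ω)) P := by
    intro i A hA
    refine Integrable.of_bound (C := 1)
      ((measurable_const.indicator hA).comp (hS.meas i)).aestronglyMeasurable ?_
    refine ae_of_all _ fun ω => ?_
    by_cases h : X i ω ∈ A <;> simp [h]
  ext A hA
  have hc := hS.cond n hn A hA
  have h1 := setIntegral_condExp hle (intg (n+1) A hA) hB
  rw [setIntegral_congr_ae (g := fun ω =>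
        (α / n) * ∑ i ∈ Finset.Icc 1 n, A.indicator (fun _ => (1:ℝ)) (X i ω)
        + (1 - α) * (μ A).toReal) (hle _ hB) (hc.mono fun x hx _ => hx), key _ A hA,
      integral_add, integral_const_mul, integral_finsetSum] at h1
  rotate_left
  · exact fun i _ => (intg i A hA).integrableOn
  · exact ((integrable_finsetSum _ fun i _ => intg i A hA).const_mul _).integrableOn
  · exact (integrable_const _)
  simp only [key _ A hA] at h1
  have hfin : ∀ i, (P.restrict B).map (X i) A ≠ ∞ := by
    intro i
    rw [Measure.map_apply (hS.meas i) hA]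
    exact measure_ne_top _ _
  rw [← ENNReal.toReal_eq_toReal_iff' (hfin _), ← h1]
  · simp only [Measure.coe_add, Pi.add_apply, Measure.coe_smul, Pi.smul_apply,
      Measure.coe_finsetSum, Finset.sum_apply, smul_eq_mul]
    rw [ENNReal.toReal_add, ENNReal.toReal_mul, ENNReal.toReal_mul, ENNReal.toReal_mul,
      ENNReal.toReal_ofReal hαn, ENNReal.toReal_ofReal h1α, ENNReal.toReal_sum fun i _ => hfin i]
    · simp [Measure.real]; ring
    · exact ENNReal.mul_ne_top ENNReal.ofReal_ne_top (ENNReal.sum_ne_top.2 fun i _ => hfin i)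
    · exact ENNReal.mul_ne_top (ENNReal.mul_ne_top ENNReal.ofReal_ne_top (measure_ne_top _ _))
        (measure_ne_top _ _)
  · simp only [Measure.coe_add, Pi.add_apply, Measure.coe_smul, Pi.smul_apply,
      Measure.coe_finsetSum, Finset.sum_apply, smul_eq_mul]
    refine ENNReal.add_ne_top.2 ⟨?_, ?_⟩
    · exact ENNReal.mul_ne_top ENNReal.ofReal_ne_top (ENNReal.sum_ne_top.2 fun i _ => hfin i)
    · exact ENNReal.mul_ne_top (ENNReal.mul_ne_top ENNReal.ofReal_ne_top (measure_ne_top _ _))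
        (measure_ne_top _ _)

lemma law (hS : IsSRRW P α μ X) (n : ℕ) (hn : 1 ≤ n) : P.map (X n) = μ := by
  have := hS.probP
  induction n using Nat.strong_induction_on with
  | _ n ih =>
    rcases Nat.lt_or_ge 1 n with h | h
    · obtain ⟨k, rfl⟩ : ∃ k, n = k + 1 := ⟨n - 1, by omega⟩
      have hk : 1 ≤ k := by omega
      have := map_restrict hS hk (B := Set.univ) MeasurableSet.univ
      rw [Measure.restrict_univ] at this
      rw [this, Finset.sum_congr rfl (g := fun _ => μ) fun i hi => ?_]
      · simp only [Finset.sum_const, Nat.card_Icc, Nat.add_sub_cancel, measure_univ, mul_one]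
        have hk0 : (0:ℝ) < k := by exact_mod_cast hk
        rw [← Nat.cast_smul_eq_nsmul ℝ≥0∞, smul_smul, ← add_smul]
        have : ENNReal.ofReal (α / k) * (k : ℝ≥0∞) + ENNReal.ofReal (1 - α) = 1 := by
          rw [← ENNReal.ofReal_natCast, ← ENNReal.ofReal_mul (div_nonneg hS.alpha_nonneg hk0.le),
            div_mul_cancel₀ _ hk0.ne', ← ENNReal.ofReal_add hS.alpha_nonneg
            (by linarith [hS.alpha_lt_one])]
          simp
        rw [this, one_smul]
      · simp only [Finset.mem_Icc] at hi
        exact ih i (by omega) hi.1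
    · have : n = 1 := by omega
      subst this
      exact hS.law_one

lemma integrable_comp (hS : IsSRRW P α μ X) {g : E → ℝ} (hg : Integrable g μ) {n : ℕ}
    (hn : 1 ≤ n) : Integrable (fun ω => g (X n ω)) P := by
  have h := law hS n hn
  rw [← h] at hg
  exact hg.comp_measurable (hS.meas n)

lemma integral_comp (hS : IsSRRW P α μ X) {g : E → ℝ} (hg : Measurable g) {n : ℕ}
    (hn : 1 ≤ n) : ∫ ω, g (X n ω) ∂P = ∫ x, g x ∂μ := by
  rw [← law hS n hn, integral_map (hS.meas n).aemeasurable hg.aestronglyMeasurable]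

lemma condExp_comp (hS : IsSRRW P α μ X) {g : E → ℝ} (hgm : Measurable g) (hg : Integrable g μ)
    {n : ℕ} (hn : 1 ≤ n) :
    P[(fun ω => g (X (n+1) ω)) | srrwFiltration X n] =ᵐ[P]
      fun ω => (α / n) * ∑ i ∈ Finset.Icc 1 n, g (X i ω) + (1 - α) * ∫ x, g x ∂μ := by
  have := hS.probP
  have := hS.probμ
  have hle := filt_le hS.meas n
  have hαn : 0 ≤ α / n := div_nonneg hS.alpha_nonneg (Nat.cast_nonneg n)
  have h1α : 0 ≤ 1 - α := by linarith [hS.alpha_lt_one]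
  have hi : ∀ i ∈ Finset.Icc 1 n, Integrable (fun ω => g (X i ω)) P := fun i hi =>
    integrable_comp hS hg (Finset.mem_Icc.1 hi).1
  have hsum : Integrable (fun ω => (α / n) * ∑ i ∈ Finset.Icc 1 n, g (X i ω)) P :=
    (integrable_finsetSum _ hi).const_mul _
  symm
  refine ae_eq_condExp_of_forall_setIntegral_eq hle (integrable_comp hS hg (by omega)) ?_ ?_ ?_
  · exact fun B _ _ => (hsum.add (integrable_const _)).integrableOn
  · intro B hB _
    have hm := map_restrict hS hn hB
    have e1 : ∀ i, ∫ ω in B, g (X i ω) ∂P = ∫ x, g x ∂((P.restrict B).map (X i)) := fun i =>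
      (integral_map (hS.meas i).aemeasurable hgm.aestronglyMeasurable).symm
    have hint : ∀ i ∈ Finset.Icc 1 n, Integrable g ((P.restrict B).map (X i)) := by
      intro i h
      exact (integrable_map_measure hgm.aestronglyMeasurable (hS.meas i).aemeasurable).2
        (hi i h).integrableOn
    rw [e1 (n+1), hm, integral_add_measure, integral_smul_measure, integral_smul_measure,
      integral_finsetSum_measure hint, integral_add hsum.integrableOn (integrable_const _),
      integral_const_mul, integral_finsetSum _ fun i h => (hi i h).integrableOn]
    · simp only [e1, ENNReal.toReal_ofReal hαn, ENNReal.toReal_mul, ENNReal.toReal_ofReal h1α,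
        smul_eq_mul]
      simp [Measure.real]; ring
    · exact (integrable_finsetSum_measure.2 hint).smul_measure ENNReal.ofReal_ne_top
    · exact hg.smul_measure (ENNReal.mul_ne_top ENNReal.ofReal_ne_top (measure_ne_top _ _))
  · refine StronglyMeasurable.aestronglyMeasurable (Measurable.stronglyMeasurable ?_)
    refine ((Finset.measurable_sum _ fun i h => ?_).const_mul _).add_const _
    exact hgm.comp (meas_filt X h)

lemma sum_meas {g : E → ℝ} (hgm : Measurable g) (n : ℕ) :
    Measurable[srrwFiltration X n] (fun ω => ∑ i ∈ Finset.Icc 1 n, g (X i ω)) :=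
  Finset.measurable_sum _ fun _ h => hgm.comp (meas_filt X h)

lemma l2_bound (hS : IsSRRW P α μ X) (hα : α ≤ 1 / 2) {g : E → ℝ} (hgm : Measurable g) {C : ℝ}
    (hC : ∀ x, |g x| ≤ C) (hg0 : ∫ x, g x ∂μ = 0) (n : ℕ) :
    ∫ ω, (∑ i ∈ Finset.Icc 1 n, g (X i ω)) ^ 2 ∂P ≤ n * (harmonic n : ℝ) * ∫ x, g x ^ 2 ∂μ := by
  have := hS.probP
  have := hS.probμ
  have hg : Integrable g μ := Integrable.of_bound hgm.aestronglyMeasurable C (ae_of_all _ hC)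
  have hg2 : 0 ≤ ∫ x, g x ^ 2 ∂μ := integral_nonneg fun x => sq_nonneg _
  have hbd : ∀ n ω, |∑ i ∈ Finset.Icc 1 n, g (X i ω)| ≤ n * C := by
    intro n ω
    refine (Finset.abs_sum_le_sum_abs _ _).trans ((Finset.sum_le_sum fun i _ => hC _).trans ?_)
    simp
  have hSm : ∀ n, Measurable (fun ω => ∑ i ∈ Finset.Icc 1 n, g (X i ω)) := fun n =>
    (sum_meas hgm n).mono (filt_le hS.meas n) le_rfl
  have hS2 : ∀ n, Integrable (fun ω => (∑ i ∈ Finset.Icc 1 n, g (X i ω)) ^ 2) P := by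
    intro n
    refine Integrable.of_bound ((hSm n).pow_const 2).aestronglyMeasurable ((n * C)^2)
      (ae_of_all _ fun ω => ?_)
    rw [Real.norm_eq_abs, abs_pow]
    exact pow_le_pow_left₀ (abs_nonneg _) (hbd n ω) 2
  induction n with
  | zero => simp
  | succ n ih =>
    rcases Nat.eq_zero_or_pos n with rfl | hn
    · simp only [zero_add, Finset.Icc_self, Finset.sum_singleton, Nat.cast_one, one_mul]
      rw [integral_comp hS (g := fun x => g x ^ 2) (hgm.pow_const 2) le_rfl]
      simp [harmonic]
    · have hn0 : (0:ℝ) < n := by exact_mod_cast hn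
      have hY : Integrable (fun ω => g (X (n+1) ω)) P := integrable_comp hS hg (by omega)
      have hSY : Integrable ((fun ω => ∑ i ∈ Finset.Icc 1 n, g (X i ω)) *
          (fun ω => g (X (n+1) ω))) P :=
        hY.bdd_mul (c := n * C) (hSm n).aestronglyMeasurable (ae_of_all _ (hbd n))
      have hY2 : Integrable (fun ω => g (X (n+1) ω) ^ 2) P := by
        refine Integrable.of_bound ((hgm.comp (hS.meas _)).pow_const 2).aestronglyMeasurable (C^2)
          (ae_of_all _ fun ω => ?_)
        rw [Real.norm_eq_abs, abs_pow]
        exact pow_le_pow_left₀ (abs_nonneg _) (hC _) 2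
      have hcross : ∫ ω, (∑ i ∈ Finset.Icc 1 n, g (X i ω)) * g (X (n+1) ω) ∂P
          = α / n * ∫ ω, (∑ i ∈ Finset.Icc 1 n, g (X i ω)) ^ 2 ∂P := by
        have h1 := condExp_mul_of_stronglyMeasurable_left
          (sum_meas (X := X) hgm n).stronglyMeasurable hSY hY
        have h2 := condExp_comp hS hgm hg hn
        have h3 := integral_condExp (f := ((fun ω => ∑ i ∈ Finset.Icc 1 n, g (X i ω)) *
          (fun ω => g (X (n+1) ω)))) (μ := P) (filt_le hS.meas n)
        rw [← integral_const_mul]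
        refine h3.symm.trans (integral_congr_ae ?_)
        filter_upwards [h1, h2] with ω e1 e2
        rw [e1, Pi.mul_apply, e2, hg0]
        ring
      have hexp : ∫ ω, (∑ i ∈ Finset.Icc 1 (n+1), g (X i ω)) ^ 2 ∂P
          = (1 + 2 * α / n) * ∫ ω, (∑ i ∈ Finset.Icc 1 n, g (X i ω)) ^ 2 ∂P
            + ∫ x, g x ^ 2 ∂μ := by
        rw [← integral_comp hS (g := fun x => g x ^ 2) (hgm.pow_const 2) (n := n+1) (by omega)]
        have : ∀ ω, (∑ i ∈ Finset.Icc 1 (n+1), g (X i ω)) ^ 2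
            = (∑ i ∈ Finset.Icc 1 n, g (X i ω)) ^ 2
              + 2 * ((∑ i ∈ Finset.Icc 1 n, g (X i ω)) * g (X (n+1) ω)) + g (X (n+1) ω) ^ 2 := by
          intro ω
          rw [Finset.sum_Icc_succ_top (by omega)]; ring
        simp only [this]
        have hSY' : Integrable (fun ω => 2 * ((∑ i ∈ Finset.Icc 1 n, g (X i ω)) * g (X (n+1) ω))) P :=
          hSY.const_mul 2
        have hadd : Integrable (fun ω => (∑ i ∈ Finset.Icc 1 n, g (X i ω)) ^ 2
            + 2 * ((∑ i ∈ Finset.Icc 1 n, g (X i ω)) * g (X (n+1) ω))) P := (hS2 n).add hSY'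
        rw [integral_add hadd hY2, integral_add (hS2 n) hSY', integral_const_mul, hcross]
        ring
      rw [hexp, harmonic_succ]
      push_cast
      have hU : 0 ≤ ∫ ω, (∑ i ∈ Finset.Icc 1 n, g (X i ω)) ^ 2 ∂P :=
        integral_nonneg fun x => sq_nonneg _
      calc _ ≤ (1 + 1 / (n:ℝ)) * (n * (harmonic n : ℝ) * ∫ x, g x ^ 2 ∂μ) + ∫ x, g x ^ 2 ∂μ := by
            have : 2 * α / n ≤ 1 / (n:ℝ) := by
              apply div_le_div_of_nonneg_right _ hn0.le; linarith
            gcongr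
        _ = _ := by field_simp

lemma l1_bound (hS : IsSRRW P α μ X) (hα : α ≤ 1 / 2) {h : E → ℝ} (hm : Measurable h)
    {s : ℝ} (hs1 : 1 < s) (hs2 : s < 2) (hmom : Integrable (fun x => |h x| ^ s) μ)
    (hh : Integrable h μ) {n : ℕ} (hn : 1 ≤ n) :
    ∫ ω, |∑ i ∈ Finset.Icc 1 n, (h (X i ω) - ∫ x, h x ∂μ)| ∂P ≤
      ((harmonic n : ℝ) * (∫ x, |h x| ^ s ∂μ) + 1 + 2 * ∫ x, |h x| ^ s ∂μ) * (n:ℝ) ^ (1/s) := by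
  have := hS.probP
  have := hS.probμ
  set m := ∫ x, |h x| ^ s ∂μ with hmdef
  have hm0 : 0 ≤ m := integral_nonneg fun x => by positivity
  have hn0 : (0:ℝ) < n := by exact_mod_cast hn
  set N : ℝ := (n:ℝ) ^ (1/s) with hN
  have hN0 : 0 < N := Real.rpow_pos_of_pos hn0 _
  have hNs : N ^ s = n := by
    rw [hN, ← Real.rpow_mul hn0.le]; field_simp; simp
  have hH : (0:ℝ) ≤ harmonic n := by
    have : (0:ℚ) ≤ harmonic n := Finset.sum_nonneg fun i _ => by positivity
    exact_mod_cast this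
  set A : Set E := {x | |h x| ≤ N} with hA
  have hAm : MeasurableSet A := measurableSet_le hm.abs measurable_const
  set u : E → ℝ := A.indicator h with hu
  set v : E → ℝ := Aᶜ.indicator h with hv
  have huv : ∀ x, h x = u x + v x := fun x => by
    rw [hu, hv]; exact (congrFun (Set.indicator_self_add_compl A h) x).symm
  have hum : Measurable u := hm.indicator hAm
  have hvm : Measurable v := hm.indicator hAm.compl
  have huN : ∀ x, |u x| ≤ N := by
    intro x
    by_cases hx : x ∈ A
    · rw [hu, Set.indicator_of_mem hx]; exact hx
    · rw [hu, Set.indicator_of_notMem hx]; simp [hN0.le]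
  have hui : Integrable u μ := hh.indicator hAm
  have hvi : Integrable v μ := hh.indicator hAm.compl
  have hu2 : ∀ x, u x ^ 2 ≤ N ^ (2 - s) * |h x| ^ s := by
    intro x
    by_cases hx : x ∈ A
    · rw [hu, Set.indicator_of_mem hx]
      rcases eq_or_ne (h x) 0 with h0 | h0
      · rw [h0]; simp; positivity
      have hp : 0 < |h x| := abs_pos.2 h0
      calc h x ^ 2 = |h x| ^ (2 - s) * |h x| ^ s := by
            rw [← Real.rpow_add hp, sub_add_cancel]; norm_num
        _ ≤ _ := by
            apply mul_le_mul_of_nonneg_right _ (by positivity)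
            exact Real.rpow_le_rpow hp.le hx (by linarith)
    · rw [hu, Set.indicator_of_notMem hx]
      simp; positivity
  have hv1 : ∀ x, |v x| ≤ N ^ (1 - s) * |h x| ^ s := by
    intro x
    by_cases hx : x ∈ A
    · rw [hv, Set.indicator_of_notMem (by simpa using hx)]
      simp; positivity
    · rw [hv, Set.indicator_of_mem (by simpa using hx)]
      have hx' : N < |h x| := by simpa [hA] using hx
      have hp : 0 < |h x| := hN0.trans hx'
      calc |h x| = |h x| ^ (1 - s) * |h x| ^ s := by
            rw [← Real.rpow_add hp, sub_add_cancel]; norm_num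
        _ ≤ _ := by
            apply mul_le_mul_of_nonneg_right _ (by positivity)
            exact Real.rpow_le_rpow_of_nonpos hN0 hx'.le (by linarith)
  have hu2i : Integrable (fun x => u x ^ 2) μ := by
    refine Integrable.of_bound (hum.pow_const 2).aestronglyMeasurable (N^2)
      (ae_of_all _ fun ω => ?_)
    rw [Real.norm_eq_abs, abs_pow]
    exact pow_le_pow_left₀ (abs_nonneg _) (huN _) 2
  have Eu2 : ∫ x, u x ^ 2 ∂μ ≤ N ^ (2 - s) * m := by
    rw [hmdef, ← integral_const_mul]
    exact integral_mono hu2i (hmom.const_mul _) hu2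
  have Ev1 : ∫ x, |v x| ∂μ ≤ N ^ (1 - s) * m := by
    rw [hmdef, ← integral_const_mul]
    exact integral_mono hvi.abs (hmom.const_mul _) hv1
  -- centred truncated part
  set a := ∫ x, u x ∂μ with ha
  set b := ∫ x, v x ∂μ with hb
  have hab : ∫ x, h x ∂μ = a + b := by
    rw [ha, hb, ← integral_add hui hvi]; simp only [← huv]
  have hg0 : ∫ x, (u x - a) ∂μ = 0 := by
    rw [integral_sub hui (integrable_const _)]; simp [ha]
  have hgb : ∀ x, |u x - a| ≤ N + |a| := fun x =>
    (abs_sub _ _).trans (by linarith [huN x])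
  have Eg2 : ∫ x, (u x - a) ^ 2 ∂μ ≤ N ^ (2 - s) * m := by
    refine le_trans ?_ Eu2
    have : ∀ x, (u x - a) ^ 2 = u x ^ 2 - 2 * a * u x + a ^ 2 := fun x => by ring
    simp only [this]
    have hsub : Integrable (fun x => u x ^ 2 - 2 * a * u x) μ := hu2i.sub (hui.const_mul _)
    rw [integral_add hsub (integrable_const _), integral_sub hu2i (hui.const_mul _), integral_const_mul, ← ha]
    simp
    nlinarith [sq_nonneg a]
  have L2 := l2_bound hS hα (hum.sub_const a) hgb hg0 n
  have L2' : ∫ ω, (∑ i ∈ Finset.Icc 1 n, (u (X i ω) - a)) ^ 2 ∂P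
      ≤ n * (harmonic n : ℝ) * (N ^ (2 - s) * m) :=
    L2.trans (by gcongr)
  have e2 : (n:ℝ) * N ^ (2 - s) = N ^ 2 := by
    rw [← hNs, ← Real.rpow_add hN0, add_sub_cancel]; norm_num
  have e1 : (n:ℝ) * N ^ (1 - s) = N := by
    rw [← hNs, ← Real.rpow_add hN0, add_sub_cancel]; norm_num
  have hUi : Integrable (fun ω => (∑ i ∈ Finset.Icc 1 n, (u (X i ω) - a)) ^ 2) P := by
    have hmeasU : Measurable (fun ω => ∑ i ∈ Finset.Icc 1 n, (u (X i ω) - a)) :=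
      Finset.measurable_sum _ fun i _ => (hum.comp (hS.meas i)).sub_const a
    refine Integrable.of_bound (hmeasU.pow_const 2).aestronglyMeasurable ((n * (N + |a|))^2)
      (ae_of_all _ fun ω => ?_)
    rw [Real.norm_eq_abs, abs_pow]
    refine pow_le_pow_left₀ (abs_nonneg _) ?_ 2
    refine (Finset.abs_sum_le_sum_abs _ _).trans ((Finset.sum_le_sum fun i _ => hgb _).trans ?_)
    simp [mul_add]
  have hVi : ∀ i ∈ Finset.Icc 1 n, Integrable (fun ω => |v (X i ω)| + |b|) P := fun i hi =>
    ((integrable_comp hS hvi (Finset.mem_Icc.1 hi).1).abs).add (integrable_const _)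
  have hpt : ∀ ω, |∑ i ∈ Finset.Icc 1 n, (h (X i ω) - ∫ x, h x ∂μ)| ≤
      (N⁻¹ * (∑ i ∈ Finset.Icc 1 n, (u (X i ω) - a)) ^ 2 + N)
        + ∑ i ∈ Finset.Icc 1 n, (|v (X i ω)| + |b|) := by
    intro ω
    have : ∑ i ∈ Finset.Icc 1 n, (h (X i ω) - ∫ x, h x ∂μ)
        = ∑ i ∈ Finset.Icc 1 n, (u (X i ω) - a) + ∑ i ∈ Finset.Icc 1 n, (v (X i ω) - b) := by
      rw [← Finset.sum_add_distrib]
      refine Finset.sum_congr rfl fun i _ => ?_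
      rw [hab, huv]; ring
    rw [this]
    refine (abs_add_le _ _).trans (add_le_add ?_ ?_)
    · set S := ∑ i ∈ Finset.Icc 1 n, (u (X i ω) - a)
      have : N * |S| ≤ S ^ 2 + N ^ 2 := by
        rw [← sq_abs S]; nlinarith [sq_nonneg (|S| - N), sq_nonneg (|S| + N)]
      have h2 : |S| = N⁻¹ * (N * |S|) := by field_simp
      rw [h2]
      calc N⁻¹ * (N * |S|) ≤ N⁻¹ * (S ^ 2 + N ^ 2) := by gcongr
        _ = _ := by field_simp
    · exact (Finset.abs_sum_le_sum_abs _ _).trans (Finset.sum_le_sum fun i _ => abs_sub _ _)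
  have hI1 : Integrable (fun ω => N⁻¹ * (∑ i ∈ Finset.Icc 1 n, (u (X i ω) - a)) ^ 2 + N) P :=
    (hUi.const_mul _).add (integrable_const _)
  have hI2 : Integrable (fun ω => ∑ i ∈ Finset.Icc 1 n, (|v (X i ω)| + |b|)) P :=
    integrable_finsetSum _ hVi
  have hbb : |b| ≤ N ^ (1 - s) * m := (abs_integral_le_integral_abs).trans Ev1
  calc _ ≤ ∫ ω, ((N⁻¹ * (∑ i ∈ Finset.Icc 1 n, (u (X i ω) - a)) ^ 2 + N)
        + ∑ i ∈ Finset.Icc 1 n, (|v (X i ω)| + |b|)) ∂P :=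
        integral_mono_of_nonneg (ae_of_all _ fun ω => abs_nonneg _) (hI1.add hI2)
          (ae_of_all _ hpt)
    _ = N⁻¹ * (∫ ω, (∑ i ∈ Finset.Icc 1 n, (u (X i ω) - a)) ^ 2 ∂P) + N
        + n * (∫ x, |v x| ∂μ + |b|) := by
        rw [integral_add hI1 hI2, integral_add (hUi.const_mul _) (integrable_const _),
          integral_const_mul, integral_finsetSum _ hVi]
        congr 1
        · simp
        · rw [Finset.sum_congr rfl (g := fun _ => ∫ x, |v x| ∂μ + |b|)]
          · simp [mul_add]
          · intro i hi
            have hi1 := (Finset.mem_Icc.1 hi).1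
            rw [integral_add (integrable_comp hS hvi hi1).abs (integrable_const _),
              integral_comp hS (g := fun x => |v x|) hvm.abs hi1]
            simp
    _ ≤ N⁻¹ * (n * (harmonic n : ℝ) * (N ^ (2 - s) * m)) + N
        + n * (N ^ (1 - s) * m + N ^ (1 - s) * m) := by gcongr
    _ = N⁻¹ * ((harmonic n : ℝ) * m * (n * N ^ (2 - s))) + N + 2 * m * (n * N ^ (1 - s)) := by ring
    _ = _ := by rw [e1, e2]; field_simp

lemma harmonic_bound {ε : ℝ} (hε : 0 < ε) {n : ℕ} (hn : 1 ≤ n) :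
    (harmonic n : ℝ) ≤ (1 + 1 / ε) * (n:ℝ) ^ ε := by
  have h1 := harmonic_le_one_add_log n
  have h2 := Real.log_le_rpow_div (Nat.cast_nonneg n) hε
  have h3 : 1 ≤ (n:ℝ) ^ ε := Real.one_le_rpow (by exact_mod_cast hn) hε.le
  rw [add_mul, one_mul, one_div_mul_eq_div]
  linarith

lemma l1_rate (hS : IsSRRW P α μ X) (hα : α ≤ 1 / 2) {h : E → ℝ} (hm : Measurable h)
    {s : ℝ} (hs1 : 1 < s) (hs2 : s < 2) (hmom : Integrable (fun x => |h x| ^ s) μ)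
    (hh : Integrable h μ) {ε : ℝ} (hε : 0 < ε) :
    ∃ K : ℝ, 0 ≤ K ∧ ∀ n : ℕ, 1 ≤ n →
    ∫ ω, |∑ i ∈ Finset.Icc 1 n, (h (X i ω) - ∫ x, h x ∂μ)| ∂P ≤ K * (n:ℝ) ^ (1/s + ε) := by
  set m := ∫ x, |h x| ^ s ∂μ with hmdef
  have hm0 : 0 ≤ m := integral_nonneg fun x => by positivity
  refine ⟨(1 + 1/ε) * m + 1 + 2 * m, by positivity, fun n hn => ?_⟩
  refine (l1_bound hS hα hm hs1 hs2 hmom hh hn).trans ?_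
  have hn0 : (0:ℝ) < n := by exact_mod_cast hn
  rw [add_comm (1/s), Real.rpow_add hn0, ← mul_assoc, ← hmdef]
  gcongr
  have h1 := harmonic_bound hε hn
  have h3 : 1 ≤ (n:ℝ) ^ ε := Real.one_le_rpow (by exact_mod_cast hn) hε.le
  have h4 : (harmonic n : ℝ) * m ≤ (1 + 1 / ε) * (n:ℝ) ^ ε * m := by gcongr
  nlinarith

lemma integrable_of_mom [IsProbabilityMeasure μ] {h : E → ℝ} (hm : Measurable h)
    {s : ℝ} (hs1 : 1 < s) (hmom : Integrable (fun x => |h x| ^ s) μ) : Integrable h μ := by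
  refine Integrable.mono' (hmom.add (integrable_const (1:ℝ))) hm.aestronglyMeasurable
    (ae_of_all _ fun x => ?_)
  rw [Real.norm_eq_abs]
  simp only [Pi.add_apply]
  rcases le_total |h x| 1 with h1 | h1
  · have : 0 ≤ |h x| ^ s := by positivity
    linarith
  · have := Real.self_le_rpow_of_one_le h1 hs1.le
    linarith

def filt {Ω E : Type*} [m0 : MeasurableSpace Ω] [MeasurableSpace E]
    (X : ℕ → Ω → E) (hX : ∀ n, Measurable (X n)) : Filtration ℕ m0 where
  seq n := srrwFiltration X (n+1)
  mono' _ _ h := filt_mono X (Nat.succ_le_succ h)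
  le' n := filt_le hX (n+1)

def wt (α : ℝ) (n : ℕ) : ℝ := ∏ k ∈ Finset.range n, (1 + α / ((k + 1 : ℕ) : ℝ))

lemma wt_pos {α : ℝ} (hα : 0 ≤ α) (n : ℕ) : 0 < wt α n :=
  Finset.prod_pos fun k _ => by positivity

lemma wt_succ (α : ℝ) (n : ℕ) : wt α (n+1) = wt α n * (1 + α / ((n + 1 : ℕ) : ℝ)) :=
  Finset.prod_range_succ _ _

lemma wt_mono {α : ℝ} (hα : 0 ≤ α) : Monotone (wt α) := by
  refine monotone_nat_of_le_succ fun n => ?_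
  rw [wt_succ]
  have := (wt_pos hα n).le
  have h2 : 0 ≤ α / ((n + 1 : ℕ) : ℝ) := by positivity
  nlinarith

lemma mart (hS : IsSRRW P α μ X) {g : E → ℝ} (hgm : Measurable g) (hg : Integrable g μ)
    (hg0 : ∫ x, g x ∂μ = 0) :
    Martingale (fun n ω => (wt α n)⁻¹ * ∑ i ∈ Finset.Icc 1 (n+1), g (X i ω))
      (filt X hS.meas) P := by
  have := hS.probP
  have hint : ∀ n, Integrable (fun ω => ∑ i ∈ Finset.Icc 1 n, g (X i ω)) P := fun n =>
    integrable_finsetSum _ fun i hi => integrable_comp hS hg (Finset.mem_Icc.1 hi).1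
  refine martingale_nat ?_ ?_ ?_
  · intro n
    exact ((sum_meas hgm (n+1)).const_mul _).stronglyMeasurable
  · exact fun n => (hint _).const_mul _
  · intro n
    have hw := (wt_pos hS.alpha_nonneg n).ne'
    have hf : (fun ω => (wt α (n+1))⁻¹ * ∑ i ∈ Finset.Icc 1 (n+1+1), g (X i ω))
        = (wt α (n+1))⁻¹ • ((fun ω => ∑ i ∈ Finset.Icc 1 (n+1), g (X i ω))
          + fun ω => g (X (n+1+1) ω)) := by
      ext ω
      simp [Finset.sum_Icc_succ_top (show 1 ≤ n + 1 + 1 by omega)]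
    have hY : Integrable (fun ω => g (X (n+1+1) ω)) P := integrable_comp hS hg (by omega)
    have h1 := condExp_smul (μ := P) (wt α (n+1))⁻¹ ((fun ω => ∑ i ∈ Finset.Icc 1 (n+1), g (X i ω))
          + fun ω => g (X (n+1+1) ω)) (srrwFiltration X (n+1))
    have h2 := condExp_add (μ := P) (hint (n+1)) hY (srrwFiltration X (n+1))
    have h3 := condExp_of_stronglyMeasurable (filt_le hS.meas (n+1))
      (sum_meas (X := X) hgm (n+1)).stronglyMeasurable (hint (n+1))
    have h4 := condExp_comp hS hgm hg (n := n+1) (by omega)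
    change _ =ᵐ[P] P[(fun ω => (wt α (n+1))⁻¹ * ∑ i ∈ Finset.Icc 1 (n+1+1), g (X i ω)) |
      srrwFiltration X (n+1)]
    rw [hf]
    filter_upwards [h1, h2, h4] with ω e1 e2 e4
    rw [e1, Pi.smul_apply, e2, Pi.add_apply, h3, e4, hg0, wt_succ]
    have h5 : (1 + α / ((n + 1 : ℕ) : ℝ)) ≠ 0 := by
      have : 0 ≤ α / ((n + 1 : ℕ) : ℝ) := div_nonneg hS.alpha_nonneg (Nat.cast_nonneg _)
      positivity
    rw [smul_eq_mul, mul_inv]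
    generalize α / ((n + 1 : ℕ) : ℝ) = t at *
    field_simp
    ring

lemma ae_bound (hS : IsSRRW P α μ X) {g : E → ℝ} (hgm : Measurable g) (hg : Integrable g μ)
    (hg0 : ∫ x, g x ∂μ = 0) {K β γ : ℝ} (hK0 : 0 ≤ K) (hβ : 0 ≤ β) (hβγ : β < γ)
    (hK : ∀ n : ℕ, 1 ≤ n → ∫ ω, |∑ i ∈ Finset.Icc 1 n, g (X i ω)| ∂P ≤ K * (n:ℝ) ^ β) :
    ∀ᵐ ω ∂P, ∀ᶠ n : ℕ in atTop, |∑ i ∈ Finset.Icc 1 n, g (X i ω)| ≤ (n:ℝ) ^ γ := by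
  have := hS.probP
  have hM := mart hS hgm hg hg0
  set M : ℕ → Ω → ℝ := fun n ω => (wt α n)⁻¹ * ∑ i ∈ Finset.Icc 1 (n+1), g (X i ω) with hMdef
  have hsub : Submartingale (M ⊔ -M) (filt X hS.meas) P :=
    hM.submartingale.sup hM.neg.submartingale
  have habs : ∀ n ω, (M ⊔ -M) n ω = |M n ω| := fun n ω => rfl
  have hnn : 0 ≤ (M ⊔ -M) := fun n ω => by rw [habs]; exact abs_nonneg _
  have hMabs : ∀ n ω, |M n ω| = (wt α n)⁻¹ * |∑ i ∈ Finset.Icc 1 (n+1), g (X i ω)| := by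
    intro n ω
    rw [hMdef]
    simp only [abs_mul, abs_inv, abs_of_pos (wt_pos hS.alpha_nonneg n)]
  have hw : ∀ n, 0 < wt α n := wt_pos hS.alpha_nonneg
  set e : ℕ → NNReal := fun j => Real.toNNReal (((2:ℝ) ^ j) ^ γ / wt α (2^(j+1))) with he
  have he' : ∀ j, (e j : ℝ) = ((2:ℝ) ^ j) ^ γ / wt α (2^(j+1)) := fun j =>
    Real.coe_toNNReal _ (div_nonneg (by positivity) (hw _).le)
  set B : ℕ → Set Ω := fun j => {ω | (e j : ℝ) ≤ (Finset.range (2^(j+1) + 1)).sup'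
    Finset.nonempty_range_add_one fun k => (M ⊔ -M) k ω} with hB
  have hPB : ∀ j, P (B j) ≤ ENNReal.ofReal (K * 4 ^ β * ((2:ℝ) ^ (β - γ)) ^ j) := by
    intro j
    have h1 := maximal_ineq hsub hnn (ε := e j) (2^(j+1))
    have hI : ∫ ω in B j, (M ⊔ -M) (2^(j+1)) ω ∂P ≤
        (e j : ℝ) * (K * 4 ^ β * ((2:ℝ) ^ (β - γ)) ^ j) := by
      calc _ ≤ ∫ ω, (M ⊔ -M) (2^(j+1)) ω ∂P :=
            setIntegral_le_integral (hsub.integrable _) (ae_of_all _ fun ω => hnn _ ω)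
        _ = (wt α (2^(j+1)))⁻¹ * ∫ ω, |∑ i ∈ Finset.Icc 1 (2^(j+1)+1), g (X i ω)| ∂P := by
            rw [← integral_const_mul]; simp only [habs, hMabs]
        _ ≤ (wt α (2^(j+1)))⁻¹ * (K * ((2^(j+1) + 1 : ℕ):ℝ) ^ β) := by
            have := (hw (2^(j+1))).le
            gcongr
            exact hK _ (Nat.le_add_left 1 _)
        _ ≤ (wt α (2^(j+1)))⁻¹ * (K * (4 * (2:ℝ)^j) ^ β) := by
            have := (hw (2^(j+1))).le
            gcongr
            push_cast
            have : (1:ℝ) ≤ 2 ^ j := one_le_pow₀ (by norm_num)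
            rw [pow_succ]; linarith
        _ = _ := by
            rw [he', Real.mul_rpow (by norm_num) (by positivity), ← Real.rpow_natCast,
              ← Real.rpow_natCast, ← Real.rpow_mul (by norm_num), ← Real.rpow_mul (by norm_num),
              ← Real.rpow_mul (by norm_num)]
            have : (2:ℝ) ^ ((j:ℝ) * β) = 2 ^ ((j:ℝ) * γ) * 2 ^ ((β - γ) * j) := by
              rw [← Real.rpow_add (by norm_num)]; congr 1; ring
            rw [this]
            ring
    have hepos : (0:ℝ) < e j := by rw [he']; exact div_pos (by positivity) (hw _)
    have h2 := h1.trans (ENNReal.ofReal_le_ofReal hI)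
    rw [ENNReal.ofReal_mul hepos.le, ENNReal.ofReal_coe_nnreal] at h2
    have hne : (e j : ℝ≥0∞) ≠ 0 := by
      simpa using (show e j ≠ 0 by exact_mod_cast hepos.ne')
    exact (ENNReal.mul_le_mul_iff_right hne ENNReal.coe_ne_top).1 h2
  have hr1 : (2:ℝ) ^ (β - γ) < 1 := Real.rpow_lt_one_of_one_lt_of_neg (by norm_num) (by linarith)
  have hsum : Summable fun j : ℕ => K * 4 ^ β * ((2:ℝ) ^ (β - γ)) ^ j :=
    (summable_geometric_of_lt_one (by positivity) hr1).mul_left _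
  have hBC : (∑' j, P (B j)) ≠ ∞ :=
    ne_top_of_le_ne_top hsum.tsum_ofReal_ne_top (ENNReal.tsum_le_tsum hPB)
  filter_upwards [ae_eventually_notMem hBC] with ω hω
  obtain ⟨J, hJ⟩ := eventually_atTop.1 hω
  refine eventually_atTop.2 ⟨2^J, fun n hn => ?_⟩
  have hn1 : 1 ≤ n := Nat.one_le_two_pow.trans hn
  set j := Nat.log 2 n with hj
  have hjJ : J ≤ j := (Nat.le_log_iff_pow_le (by norm_num) (by omega)).2 hn
  have hlo : 2 ^ j ≤ n := Nat.pow_log_le_self 2 (by omega)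
  have hhi : n < 2 ^ (j+1) := Nat.lt_pow_succ_log_self (by norm_num) n
  have hnot := hJ j hjJ
  simp only [hB, Set.mem_ofPred_eq, not_le] at hnot
  have h1 := (Finset.sup'_lt_iff _).1 hnot (n-1) (by simp; omega)
  rw [habs, hMabs, he', Nat.sub_add_cancel hn1, inv_mul_eq_div, div_lt_div_iff₀ (hw _) (hw _)] at h1
  have h2 : wt α (n-1) ≤ wt α (2^(j+1)) := wt_mono hS.alpha_nonneg (by omega)
  have h3 : |∑ i ∈ Finset.Icc 1 n, g (X i ω)| ≤ ((2:ℝ)^j)^γ := by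
    have h4 : ((2:ℝ) ^ j) ^ γ * wt α (n-1) ≤ ((2:ℝ) ^ j) ^ γ * wt α (2^(j+1)) := by gcongr
    exact le_of_mul_le_mul_right (h1.le.trans h4) (hw _)
  refine h3.trans (Real.rpow_le_rpow (by positivity) (by exact_mod_cast hlo) (by linarith))

end SRRWAux

theorem stmt15 {Ω : Type*} [MeasurableSpace Ω] {d : ℕ}
    (P : Measure Ω) (α : ℝ) (μ : Measure (EuclideanSpace ℝ (Fin d)))
    (X : ℕ → Ω → EuclideanSpace ℝ (Fin d))
    (hsrrw : IsSRRW P α μ X) (hα : α ≤ 1 / 2)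
    (hmean : ∫ x, x ∂μ = 0)
    (h : EuclideanSpace ℝ (Fin d) → ℝ) (hmeas : Measurable h)
    (s : ℝ) (hs1 : 1 < s) (hs2 : s < 2)
    (hmom : Integrable (fun x => |h x| ^ s) μ)
    (ν : ℝ) (hν0 : 0 < ν) (hν1 : ν < 1 - 1 / s) :
    (∀ᵐ ω ∂P, Tendsto
        (fun n : ℕ => (n : ℝ) ^ ν *
          ((1 / (n:ℝ)) * ∑ i ∈ Finset.Icc 1 n, h (X i ω) - ∫ x, h x ∂μ))
        atTop (𝓝 0))
    ∧ Tendsto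
        (fun n : ℕ => ∫ ω, |(n : ℝ) ^ ν *
          ((1 / (n:ℝ)) * ∑ i ∈ Finset.Icc 1 n, h (X i ω) - ∫ x, h x ∂μ)| ∂P)
        atTop (𝓝 0) := by
  have := hsrrw.probP
  have := hsrrw.probμ
  have hh : Integrable h μ := SRRWAux.integrable_of_mom hmeas hs1 hmom
  set c := ∫ x, h x ∂μ with hc
  set δ : ℝ := (1 - ν - 1 / s) / 3 with hδ
  have hδ0 : 0 < δ := by rw [hδ]; linarith
  have hs0 : 0 < 1 / s := by positivity
  obtain ⟨K, hK0, hK⟩ := SRRWAux.l1_rate hsrrw hα hmeas hs1 hs2 hmom hh hδ0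
  have hrew : ∀ n : ℕ, 1 ≤ n → ∀ ω, |(n : ℝ) ^ ν *
      ((1 / (n:ℝ)) * ∑ i ∈ Finset.Icc 1 n, h (X i ω) - c)|
      = (n:ℝ) ^ (ν - 1) * |∑ i ∈ Finset.Icc 1 n, (h (X i ω) - c)| := by
    intro n hn ω
    have hn0 : (0:ℝ) < n := by exact_mod_cast hn
    have : (1 / (n:ℝ)) * ∑ i ∈ Finset.Icc 1 n, h (X i ω) - c
        = (n:ℝ)⁻¹ * ∑ i ∈ Finset.Icc 1 n, (h (X i ω) - c) := by
      rw [Finset.sum_sub_distrib]; simp; field_simp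
    rw [this, Real.rpow_sub_one hn0.ne', abs_mul, abs_mul, abs_of_pos (Real.rpow_pos_of_pos hn0 _),
      abs_of_pos (inv_pos.2 hn0)]
    ring
  have hlim : ∀ ρ : ℝ, 0 < ρ → Tendsto (fun n : ℕ => (n:ℝ) ^ (-ρ)) atTop (𝓝 0) := fun ρ hρ =>
    (tendsto_rpow_neg_atTop hρ).comp tendsto_natCast_atTop_atTop
  constructor
  · have hgm : Measurable (fun x => h x - c) := hmeas.sub_const c
    have hg0 : ∫ x, (h x - c) ∂μ = 0 := by
      rw [integral_sub hh (integrable_const _)]; simp [hc]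
    have hae := SRRWAux.ae_bound hsrrw hgm (hh.sub (integrable_const _)) hg0 hK0
      (β := 1/s + δ) (γ := 1/s + 2 * δ) (by linarith) (by linarith) hK
    filter_upwards [hae] with ω hω
    refine squeeze_zero_norm' ?_ (hlim δ hδ0)
    filter_upwards [hω, eventually_ge_atTop 1] with n hn hn1
    have hn0 : (0:ℝ) < n := by exact_mod_cast hn1
    rw [Real.norm_eq_abs, hrew n hn1]
    calc _ ≤ (n:ℝ) ^ (ν - 1) * (n:ℝ) ^ (1/s + 2 * δ) := by gcongr
      _ = _ := by rw [← Real.rpow_add hn0]; congr 1; rw [hδ]; ring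
  · have hl2 := (hlim (2 * δ) (by linarith)).const_mul K
    rw [mul_zero] at hl2
    refine squeeze_zero' (Eventually.of_forall fun n => integral_nonneg fun ω => abs_nonneg _) ?_ hl2
    filter_upwards [eventually_ge_atTop 1] with n hn1
    have hn0 : (0:ℝ) < n := by exact_mod_cast hn1
    simp only [hrew n hn1]
    rw [integral_const_mul]
    calc _ ≤ (n:ℝ) ^ (ν - 1) * (K * (n:ℝ) ^ (1/s + δ)) := by gcongr; exact hK n hn1
      _ = K * ((n:ℝ) ^ (ν - 1) * (n:ℝ) ^ (1/s + δ)) := by ring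
      _ = _ := by rw [← Real.rpow_add hn0]; congr 2; rw [hδ]; ring

end
end

section
/- Let S be a step-reinforced random walk in ℝ^d with parameter α ≤ 1/2 and step distribution μ with E‖X₁‖^s < ∞ for some s ∈ (1,2) and EX₁ = 0. Then for any ν ∈ (0, 1 − 1/s), n^ν ‖Sₙ/n − EX₁‖ → 0 almost surely and in L¹ (Marcinkiewicz–Zygmund type strong law). -/
open MeasureTheory ProbabilityTheory Filter
open scoped ENNReal Topology

noncomputable section

section SRRWAux

variable {Ω E : Type*} [mΩ : MeasurableSpace Ω] [MeasurableSpace E]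
  {P : Measure Ω} {α : ℝ} {μ : Measure E} {X : ℕ → Ω → E}

lemma srrwFiltration_le (h : IsSRRW P α μ X) (n : ℕ) : srrwFiltration X n ≤ mΩ :=
  iSup₂_le fun i _ => (h.meas i).comap_le

lemma srrwFiltration_mono : Monotone (srrwFiltration X) := by
  intro m n hmn
  refine iSup₂_le fun i hi => ?_
  have hi' : i ∈ Finset.Icc 1 n := by
    simp only [Finset.mem_Icc] at hi ⊢; omega
  exact le_iSup₂ (f := fun i (_ : i ∈ Finset.Icc 1 n) => MeasurableSpace.comap (X i) inferInstance) i hi'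

lemma srrw_meas_filt {n i : ℕ} (hi : i ∈ Finset.Icc 1 n) :
    Measurable[srrwFiltration X n] (X i) := by
  have h1 : MeasurableSpace.comap (X i) inferInstance ≤ srrwFiltration X n :=
    le_iSup₂ (f := fun i (_ : i ∈ Finset.Icc 1 n) => MeasurableSpace.comap (X i) inferInstance) i hi
  exact Measurable.mono (comap_measurable (X i)) h1 le_rfl

lemma srrw_real (h : IsSRRW P α μ X) {n : ℕ} (hn : 1 ≤ n) {B : Set Ω}
    (hB : MeasurableSet[srrwFiltration X n] B) {A : Set E} (hA : MeasurableSet A) :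
    (P.restrict B).real (X (n+1) ⁻¹' A) =
      (α / n) * ∑ i ∈ Finset.Icc 1 n, (P.restrict B).real (X i ⁻¹' A)
        + (1 - α) * (P.real B * μ.real A) := by
  have := h.probP
  have hm := srrwFiltration_le h n
  have hI : ∀ i, Integrable (fun ω => A.indicator (fun _ => (1:ℝ)) (X i ω)) P := by
    intro i
    refine (integrable_const (1:ℝ)).mono'
      ((measurable_const.indicator hA).comp (h.meas i)).aestronglyMeasurable ?_
    refine ae_of_all _ fun ω => ?_
    by_cases hx : X i ω ∈ A <;> simp [hx]
  have hJ : ∀ i, ∫ ω in B, A.indicator (fun _ => (1:ℝ)) (X i ω) ∂P =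
      (P.restrict B).real (X i ⁻¹' A) := by
    intro i
    rw [← integral_indicator_one (h.meas i hA)]
    rfl
  rw [← hJ, ← setIntegral_condExp hm (hI (n+1)) hB,
    setIntegral_congr_ae (hm _ hB) ((h.cond n hn A hA).mono fun ω hω _ => hω)]
  rw [integral_add, integral_const_mul, integral_finsetSum]
  · simp only [hJ]
    simp [Measure.real]
    ring
  · intro i _
    exact (hI i).integrableOn
  · exact ((integrable_finsetSum _ fun i _ => hI i).const_mul _).integrableOn
  · exact integrable_const _

lemma srrw_measure (h : IsSRRW P α μ X) {n : ℕ} (hn : 1 ≤ n) {B : Set Ω}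
    (hB : MeasurableSet[srrwFiltration X n] B) :
    (P.restrict B).map (X (n+1)) =
      ENNReal.ofReal (α / n) • ∑ i ∈ Finset.Icc 1 n, (P.restrict B).map (X i)
        + (ENNReal.ofReal (1 - α) * P B) • μ := by
  have := h.probP
  have := h.probμ
  have h0 := h.alpha_nonneg
  have h1 := h.alpha_lt_one
  ext A hA
  have key := srrw_real h hn hB hA
  simp only [Measure.add_apply, Measure.smul_apply, Measure.finsetSum_apply, smul_eq_mul]
  simp only [Measure.map_apply (h.meas _) hA]
  rw [← ENNReal.toReal_eq_toReal_iff' (by finiteness) (by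
    simp only [ne_eq, ENNReal.add_eq_top, not_or]
    refine ⟨ENNReal.mul_ne_top (by simp) ?_, by finiteness⟩
    exact ENNReal.sum_ne_top.2 fun i _ => by finiteness)]
  rw [ENNReal.toReal_add (ENNReal.mul_ne_top (by simp)
    (ENNReal.sum_ne_top.2 fun i _ => by finiteness)) (by finiteness)]
  rw [ENNReal.toReal_mul, ENNReal.toReal_mul, ENNReal.toReal_mul,
    ENNReal.toReal_sum (fun i _ => by finiteness), ENNReal.toReal_ofReal (by positivity),
    ENNReal.toReal_ofReal (by linarith)]
  simp only [Measure.real] at key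
  rw [key]; ring

lemma srrw_law (h : IsSRRW P α μ X) {n : ℕ} (hn : 1 ≤ n) : P.map (X n) = μ := by
  have := h.probP
  have := h.probμ
  have h0 := h.alpha_nonneg
  have h1 := h.alpha_lt_one
  induction n using Nat.strong_induction_on with
  | _ n ih =>
    rcases Nat.eq_or_lt_of_le hn with rfl | hn1
    · exact h.law_one
    obtain ⟨m, rfl⟩ : ∃ m, n = m + 1 := ⟨n - 1, by omega⟩
    have hm : 1 ≤ m := by omega
    have key := srrw_measure h hm (B := Set.univ) (@MeasurableSet.univ _ (srrwFiltration X m))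
    rw [Measure.restrict_univ] at key
    rw [key, Finset.sum_congr rfl (fun i hi => ih i (by simp at hi; omega) (by simp at hi; omega))]
    have hm0 : (m : ℝ) ≠ 0 := by positivity
    ext A hA
    simp only [Measure.add_apply, Measure.smul_apply, Measure.finsetSum_apply, smul_eq_mul,
      Finset.sum_const, measure_univ, mul_one, Nat.card_Icc, nsmul_eq_mul, add_tsub_cancel_right]
    rw [← mul_assoc, ← add_mul]
    have : ENNReal.ofReal (α / m) * (m : ℝ≥0∞) + ENNReal.ofReal (1 - α) = 1 := by
      rw [← ENNReal.ofReal_natCast, ← ENNReal.ofReal_mul (by positivity),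
        ← ENNReal.ofReal_add (by positivity) (by linarith)]
      rw [div_mul_cancel₀ _ hm0]; simp
    rw [this, one_mul]

lemma srrw_mp (h : IsSRRW P α μ X) {n : ℕ} (hn : 1 ≤ n) : MeasurePreserving (X n) P μ :=
  ⟨h.meas n, srrw_law h hn⟩

lemma srrw_int (h : IsSRRW P α μ X) {n : ℕ} (hn : 1 ≤ n) {φ : E → ℝ} (hφ : Integrable φ μ) :
    Integrable (fun ω => φ (X n ω)) P :=
  (srrw_mp h hn).integrable_comp_of_integrable hφ

lemma srrw_integral (h : IsSRRW P α μ X) {n : ℕ} (hn : 1 ≤ n) {φ : E → ℝ} (hφ : Measurable φ) :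
    ∫ ω, φ (X n ω) ∂P = ∫ x, φ x ∂μ := by
  rw [← srrw_law h hn, integral_map (h.meas n).aemeasurable hφ.aestronglyMeasurable]

/-- Additive functional of the walk. -/
def srrwW (X : ℕ → Ω → E) (φ : E → ℝ) (n : ℕ) (ω : Ω) : ℝ := ∑ i ∈ Finset.Icc 1 n, φ (X i ω)

lemma srrwW_succ (φ : E → ℝ) (n : ℕ) (ω : Ω) :
    srrwW X φ (n+1) ω = srrwW X φ n ω + φ (X (n+1) ω) := by
  unfold srrwW
  rw [Finset.sum_Icc_succ_top (by omega)]

lemma srrwW_meas (φ : E → ℝ) (hφ : Measurable φ) (n : ℕ) :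
    Measurable[srrwFiltration X n] (srrwW X φ n) := by
  unfold srrwW
  exact Finset.measurable_fun_sum _ fun i hi => hφ.comp (srrw_meas_filt hi)

lemma srrwW_int (h : IsSRRW P α μ X) {φ : E → ℝ} (hφ : Integrable φ μ) (n : ℕ) :
    Integrable (srrwW X φ n) P := by
  unfold srrwW
  exact integrable_finsetSum _ fun i hi => srrw_int h (by simp at hi; omega) hφ

lemma srrw_condExp (h : IsSRRW P α μ X) {n : ℕ} (hn : 1 ≤ n) {φ : E → ℝ} (hφm : Measurable φ)
    (hφ : Integrable φ μ) (hφ0 : ∫ x, φ x ∂μ = 0) :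
    P[(fun ω => φ (X (n+1) ω)) | srrwFiltration X n] =ᵐ[P]
      fun ω => (α / n) * srrwW X φ n ω := by
  have := h.probP
  have := h.probμ
  have h0 := h.alpha_nonneg
  have h1 := h.alpha_lt_one
  have hm := srrwFiltration_le h n
  symm
  refine ae_eq_condExp_of_forall_setIntegral_eq hm (srrw_int h (by omega) hφ) ?_ ?_ ?_
  · intro s _ _
    exact ((srrwW_int h hφ n).const_mul _).integrableOn
  · intro B hB _
    have hi : ∀ i, 1 ≤ i → Integrable φ ((P.restrict B).map (X i)) := by
      intro i hi
      rw [integrable_map_measure hφm.aestronglyMeasurable (h.meas i).aemeasurable]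
      exact (srrw_int h hi hφ).integrableOn
    have e : ∀ i, ∫ ω in B, φ (X i ω) ∂P = ∫ x, φ x ∂((P.restrict B).map (X i)) := by
      intro i
      rw [integral_map (h.meas i).aemeasurable hφm.aestronglyMeasurable]
    rw [e (n+1), srrw_measure h hn hB, integral_add_measure, integral_smul_measure,
      integral_smul_measure, hφ0, integral_finsetSum_measure]
    · simp only [← e]
      rw [integral_const_mul]
      unfold srrwW
      rw [integral_finsetSum]
      · simp [ENNReal.toReal_ofReal (show 0 ≤ α / n by positivity)]
      · intro i hi
        exact (srrw_int h (by simp at hi; omega) hφ).integrableOn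
    · intro i hi'
      exact hi i (by simp at hi'; omega)
    · refine Integrable.smul_measure ?_ (by simp)
      rw [integrable_finsetSum_measure]
      intro i hi'
      exact hi i (by simp at hi'; omega)
    · exact hφ.smul_measure (by finiteness)
  · exact ((srrwW_meas φ hφm n).const_mul _).stronglyMeasurable.aestronglyMeasurable

lemma srrw_L2 (h : IsSRRW P α μ X) (hα : α ≤ 1/2) {φ : E → ℝ} (hφm : Measurable φ) {K : ℝ}
    (hK : ∀ x, |φ x| ≤ K) (hφ0 : ∫ x, φ x ∂μ = 0) (n : ℕ) :
    ∫ ω, (srrwW X φ n ω)^2 ∂P ≤ (∫ x, (φ x)^2 ∂μ) * (n * (harmonic n : ℝ)) := by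
  have := h.probP
  have := h.probμ
  have h0 := h.alpha_nonneg
  have hφ : Integrable φ μ := (integrable_const K).mono' hφm.aestronglyMeasurable
    (ae_of_all _ fun x => by simpa using hK x)
  have hWm : ∀ n, Measurable (srrwW X φ n) := fun n =>
    (srrwW_meas φ hφm n).mono (srrwFiltration_le h n) le_rfl
  have hWb : ∀ n ω, |srrwW X φ n ω| ≤ n * K := by
    intro n ω
    unfold srrwW
    refine (Finset.abs_sum_le_sum_abs _ _).trans ((Finset.sum_le_sum fun i _ => hK _).trans ?_)
    simp
  have hK0 : ∀ ω, 0 ≤ K := fun ω => (abs_nonneg _).trans (hK (X 0 ω))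
  set σ := ∫ x, (φ x)^2 ∂μ with hσ
  have hσ0 : 0 ≤ σ := integral_nonneg fun x => sq_nonneg _
  have hint2 : ∀ n, Integrable (fun ω => (srrwW X φ n ω)^2) P := by
    intro n
    refine (integrable_const ((n*K)^2)).mono' ((hWm n).pow_const 2).aestronglyMeasurable
      (ae_of_all _ fun ω => ?_)
    rw [Real.norm_eq_abs, abs_pow]
    exact pow_le_pow_left₀ (abs_nonneg _) (hWb n ω) 2
  have hintX2 : ∀ n, Integrable (fun ω => (φ (X n ω))^2) P := by
    intro n
    refine (integrable_const (K^2)).mono' ((hφm.comp (h.meas n)).pow_const 2).aestronglyMeasurable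
      (ae_of_all _ fun ω => ?_)
    rw [Real.norm_eq_abs, abs_pow]
    exact pow_le_pow_left₀ (abs_nonneg _) (hK _) 2
  have hintX : ∀ n m, Integrable (fun ω => srrwW X φ n ω * φ (X m ω)) P := by
    intro n m
    refine (integrable_const (n * K * K)).mono'
      ((hWm n).mul (hφm.comp (h.meas m))).aestronglyMeasurable (ae_of_all _ fun ω => ?_)
    rw [Real.norm_eq_abs, abs_mul]
    exact mul_le_mul (hWb n ω) (hK _) (abs_nonneg _) ((abs_nonneg _).trans (hWb n ω))
  have hX2 : ∀ n, 1 ≤ n → ∫ ω, (φ (X n ω))^2 ∂P = σ := fun n hn =>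
    srrw_integral h hn (hφm.pow_const 2)
  induction n with
  | zero => simp [srrwW]
  | succ n ih =>
    rcases Nat.eq_zero_or_pos n with rfl | hn
    · simp only [srrwW]
      simpa using (hX2 1 le_rfl).le
    have hn' : (0:ℝ) < n := by exact_mod_cast hn
    have cross : ∫ ω, srrwW X φ n ω * φ (X (n+1) ω) ∂P = (α / n) * ∫ ω, (srrwW X φ n ω)^2 ∂P := by
      rw [← integral_condExp (srrwFiltration_le h n), ← integral_const_mul]
      refine integral_congr_ae ?_
      have e := condExp_mul_of_stronglyMeasurable_left (μ := P) (m := srrwFiltration X n)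
        (f := srrwW X φ n) (g := fun ω => φ (X (n+1) ω))
        (srrwW_meas φ hφm n).stronglyMeasurable (hintX n (n+1)) (srrw_int h (by omega) hφ)
      filter_upwards [e, srrw_condExp h hn hφm hφ hφ0] with ω h1 h2
      have h1' : (P[fun ω => srrwW X φ n ω * φ (X (n+1) ω) | srrwFiltration X n]) ω = _ := h1
      rw [h1', Pi.mul_apply, h2]; ring
    have expand : ∫ ω, (srrwW X φ (n+1) ω)^2 ∂P =
        ∫ ω, (srrwW X φ n ω)^2 ∂P + 2 * ∫ ω, srrwW X φ n ω * φ (X (n+1) ω) ∂P + σ := by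
      have i12 : Integrable (fun ω => (srrwW X φ n ω)^2 + 2 * (srrwW X φ n ω * φ (X (n+1) ω))) P :=
        (hint2 n).add ((hintX n (n+1)).const_mul 2)
      rw [← hX2 (n+1) (by omega), ← integral_const_mul, ← integral_add (hint2 n)
        ((hintX n (n+1)).const_mul 2), ← integral_add i12 (hintX2 (n+1))]
      refine integral_congr_ae (ae_of_all _ fun ω => ?_)
      simp only [srrwW_succ]
      ring
    rw [expand, cross, harmonic_succ]
    set u := ∫ ω, (srrwW X φ n ω)^2 ∂P
    have hu : 0 ≤ u := integral_nonneg fun ω => sq_nonneg _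
    push_cast
    have s1 : 2 * (α / n * u) ≤ u / n := by
      rw [← mul_assoc, ← mul_div_assoc, div_mul_eq_mul_div]
      gcongr
      nlinarith
    have s2 : u / n ≤ σ * (harmonic n : ℝ) := by
      rw [div_le_iff₀ hn']; linarith
    have s3 : σ * (((n:ℝ) + 1) * ((harmonic n : ℝ) + ((n:ℝ)+1)⁻¹)) =
        σ * (n * (harmonic n : ℝ)) + σ * (harmonic n : ℝ) + σ := by
      field_simp
    rw [s3]; linarith

lemma srrw_L1_triangle (h : IsSRRW P α μ X) {φ : E → ℝ} (hφm : Measurable φ)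
    (hφ : Integrable φ μ) (n : ℕ) :
    ∫ ω, |srrwW X φ n ω| ∂P ≤ n * ∫ x, |φ x| ∂μ := by
  calc ∫ ω, |srrwW X φ n ω| ∂P ≤ ∫ ω, ∑ i ∈ Finset.Icc 1 n, |φ (X i ω)| ∂P := by
        refine integral_mono (srrwW_int h hφ n).abs ?_ fun ω => Finset.abs_sum_le_sum_abs _ _
        exact integrable_finsetSum _ fun i hi => (srrw_int h (by simp at hi; omega) hφ).abs
    _ = ∑ i ∈ Finset.Icc 1 n, ∫ x, |φ x| ∂μ := by
        rw [integral_finsetSum]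
        · refine Finset.sum_congr rfl fun i hi => ?_
          exact srrw_integral h (by simp at hi; omega) (φ := fun x => |φ x|) hφm.abs
        · exact fun i hi => (srrw_int h (by simp at hi; omega) hφ).abs
    _ = _ := by simp

lemma srrw_int_of_mom [IsFiniteMeasure μ] {φ : E → ℝ} (hφm : Measurable φ) {s : ℝ} (hs1 : 1 < s)
    (hmom : Integrable (fun x => |φ x| ^ s) μ) : Integrable φ μ := by
  refine ((integrable_const (1:ℝ)).add hmom).mono' hφm.aestronglyMeasurable
    (ae_of_all _ fun x => ?_)
  simp only [Real.norm_eq_abs, Pi.add_apply]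
  rcases le_total (|φ x|) 1 with h1 | h1
  · have := Real.rpow_nonneg (abs_nonneg (φ x)) s
    linarith
  · have := Real.rpow_le_rpow_of_exponent_le h1 hs1.le
    rw [Real.rpow_one] at this
    linarith

lemma srrw_L1_K (h : IsSRRW P α μ X) (hα : α ≤ 1/2) {φ : E → ℝ} (hφm : Measurable φ)
    (hφ0 : ∫ x, φ x ∂μ = 0) {s : ℝ} (hs1 : 1 < s) (hs2 : s < 2)
    (hmom : Integrable (fun x => |φ x| ^ s) μ) (n : ℕ) {K : ℝ} (hK : 0 < K) :
    ∫ ω, |srrwW X φ n ω| ∂P ≤ n * (2 * (K^(1-s) * ∫ x, |φ x|^s ∂μ))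
      + ((K^(2-s) * ∫ x, |φ x|^s ∂μ) * (n * (harmonic n : ℝ)) / K + K) / 2 := by
  have := h.probP
  have := h.probμ
  have hφ := srrw_int_of_mom hφm hs1 hmom
  set m := ∫ x, |φ x|^s ∂μ with hm
  set A : Set E := {x | |φ x| ≤ K} with hA
  have hAm : MeasurableSet A := measurableSet_le hφm.abs measurable_const
  set f : E → ℝ := A.indicator φ with hf
  have hfm : Measurable f := hφm.indicator hAm
  have hfb : ∀ x, |f x| ≤ K := by
    intro x
    by_cases hx : x ∈ A
    · rw [hf, Set.indicator_of_mem hx]; exact hx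
    · simp [hf, hx, hK.le]
  have hfi : Integrable f μ := hφ.indicator hAm
  have hf2i : Integrable (fun x => (f x)^2) μ := by
    refine (integrable_const (K^2)).mono' (hfm.pow_const 2).aestronglyMeasurable
      (ae_of_all _ fun x => ?_)
    rw [Real.norm_eq_abs, abs_pow]
    exact pow_le_pow_left₀ (abs_nonneg _) (hfb x) 2
  have hf2 : ∫ x, (f x)^2 ∂μ ≤ K^(2-s) * m := by
    rw [hm, ← integral_const_mul]
    refine integral_mono hf2i (hmom.const_mul _) fun x => ?_
    have hnn : 0 ≤ |φ x|^s := Real.rpow_nonneg (abs_nonneg _) _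
    by_cases hx : x ∈ A
    · simp only [hf, hx, Set.indicator_of_mem]
      rcases eq_or_ne (φ x) 0 with h0 | h0
      · rw [h0]; simp; positivity
      have hp : 0 < |φ x| := abs_pos.2 h0
      have e : (φ x)^2 = |φ x|^(2-s) * |φ x|^s := by
        rw [← Real.rpow_add hp, sub_add_cancel, ← sq_abs]; norm_num
      rw [e]
      exact mul_le_mul_of_nonneg_right
        (Real.rpow_le_rpow hp.le hx (by linarith)) hnn
    · simp only [hf, hx, not_false_eq_true, Set.indicator_of_notMem]
      simp; positivity
  have hd : ∫ x, |φ x - f x| ∂μ ≤ K^(1-s) * m := by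
    rw [hm, ← integral_const_mul]
    refine integral_mono (hφ.sub hfi).abs (hmom.const_mul _) fun x => ?_
    have hnn : 0 ≤ |φ x|^s := Real.rpow_nonneg (abs_nonneg _) _
    by_cases hx : x ∈ A
    · simp only [hf, hx, Set.indicator_of_mem]
      simp; positivity
    · simp only [hf, hx, not_false_eq_true, Set.indicator_of_notMem, sub_zero]
      have hx' : K < |φ x| := not_le.1 hx
      have hp : 0 < |φ x| := hK.trans hx'
      have e : |φ x| = |φ x|^(1-s) * |φ x|^s := by
        rw [← Real.rpow_add hp]; simp
      calc |φ x| = |φ x|^(1-s) * |φ x|^s := e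
        _ ≤ _ := mul_le_mul_of_nonneg_right
          (Real.rpow_le_rpow_of_nonpos hK hx'.le (by linarith)) hnn
  set c := ∫ x, f x ∂μ with hc
  have hcb : |c| ≤ K^(1-s) * m := by
    have e : c = - ∫ x, (φ x - f x) ∂μ := by
      rw [integral_sub hφ hfi, hφ0, hc]; ring
    rw [e, abs_neg]
    exact (abs_integral_le_integral_abs).trans hd
  set g1 : E → ℝ := fun x => f x - c with hg1
  set g2 : E → ℝ := fun x => (φ x - f x) + c with hg2
  have hg1m : Measurable g1 := hfm.sub_const c
  have hg2m : Measurable g2 := (hφm.sub hfm).add_const c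
  have hg2i : Integrable g2 μ := (hφ.sub hfi).add (integrable_const c)
  have hg1i : Integrable g1 μ := hfi.sub (integrable_const c)
  have hg10 : ∫ x, g1 x ∂μ = 0 := by
    rw [hg1, integral_sub hfi (integrable_const c)]; simp [hc]
  have hg1s : ∫ x, (g1 x)^2 ∂μ ≤ K^(2-s) * m := by
    refine le_trans ?_ hf2
    have e : ∫ x, (g1 x)^2 ∂μ = ∫ x, (f x)^2 ∂μ - c^2 := by
      have e1 : ∀ x, (g1 x)^2 = (f x)^2 - ((2*c) * f x - c^2) := fun x => by
        simp only [hg1]; ring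
      have i12 : Integrable (fun x => (2*c) * f x - c^2) μ :=
        (hfi.const_mul _).sub (integrable_const _)
      simp_rw [e1]
      rw [integral_sub hf2i i12,
        integral_sub (hfi.const_mul _) (integrable_const _), integral_const_mul, ← hc]
      simp; ring
    rw [e]; nlinarith [sq_nonneg c]
  have hg2s : ∫ x, |g2 x| ∂μ ≤ 2 * (K^(1-s) * m) := by
    calc ∫ x, |g2 x| ∂μ ≤ ∫ x, (|φ x - f x| + |c|) ∂μ :=
          integral_mono hg2i.abs ((hφ.sub hfi).abs.add (integrable_const _))
            fun x => abs_add_le _ _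
      _ = ∫ x, |φ x - f x| ∂μ + |c| := by
          have i1 : Integrable (fun x => |φ x - f x|) μ := (hφ.sub hfi).abs
          rw [integral_add i1 (integrable_const _)]; simp
      _ ≤ _ := by linarith
  have hg1b : ∀ x, |g1 x| ≤ K + |c| := fun x =>
    (abs_sub _ _).trans (add_le_add (hfb x) le_rfl)
  have L2 := srrw_L2 h hα hg1m hg1b hg10 n
  have hW1i := srrwW_int h hg1i n
  have hW1m : Measurable (srrwW X g1 n) :=
    (srrwW_meas g1 hg1m n).mono (srrwFiltration_le h n) le_rfl
  have hW2i : Integrable (fun ω => (srrwW X g1 n ω)^2) P := by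
    refine (integrable_const ((n*(K+|c|))^2)).mono' (hW1m.pow_const 2).aestronglyMeasurable
      (ae_of_all _ fun ω => ?_)
    rw [Real.norm_eq_abs, abs_pow]
    refine pow_le_pow_left₀ (abs_nonneg _) ?_ 2
    unfold srrwW
    refine (Finset.abs_sum_le_sum_abs _ _).trans ((Finset.sum_le_sum fun i _ => hg1b _).trans ?_)
    simp [mul_add]
  have L1 : ∫ ω, |srrwW X g1 n ω| ∂P ≤ ((∫ ω, (srrwW X g1 n ω)^2 ∂P) / K + K) / 2 := by
    calc ∫ ω, |srrwW X g1 n ω| ∂P ≤ ∫ ω, ((srrwW X g1 n ω)^2 / K + K) / 2 ∂P := by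
          refine integral_mono hW1i.abs (((hW2i.div_const K).add (integrable_const K)).div_const 2)
            fun ω => ?_
          change |srrwW X g1 n ω| ≤ ((srrwW X g1 n ω)^2 / K + K) / 2
          rw [← sq_abs]
          set w := |srrwW X g1 n ω|
          have : w^2 / K + K - 2 * w = (w - K)^2 / K := by field_simp; ring
          have : 0 ≤ (w - K)^2 / K := by positivity
          linarith
      _ = _ := by
          rw [integral_div, integral_add (hW2i.div_const K) (integrable_const K), integral_div]
          simp
  have hsplit : ∀ ω, srrwW X φ n ω = srrwW X g2 n ω + srrwW X g1 n ω := by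
    intro ω
    unfold srrwW
    rw [← Finset.sum_add_distrib]
    refine Finset.sum_congr rfl fun i _ => ?_
    simp only [hg1, hg2]; ring
  have hH : 0 ≤ (n * (harmonic n : ℝ)) := by
    have : 0 ≤ harmonic n := by
      unfold harmonic
      exact Finset.sum_nonneg fun i _ => by positivity
    have : (0:ℝ) ≤ harmonic n := by exact_mod_cast this
    positivity
  calc ∫ ω, |srrwW X φ n ω| ∂P ≤ ∫ ω, (|srrwW X g2 n ω| + |srrwW X g1 n ω|) ∂P := by
        refine integral_mono (srrwW_int h hφ n).abs ((srrwW_int h hg2i n).abs.add hW1i.abs)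
          fun ω => ?_
        change |srrwW X φ n ω| ≤ |srrwW X g2 n ω| + |srrwW X g1 n ω|
        rw [hsplit]
        exact abs_add_le _ _
    _ = ∫ ω, |srrwW X g2 n ω| ∂P + ∫ ω, |srrwW X g1 n ω| ∂P :=
        integral_add (srrwW_int h hg2i n).abs hW1i.abs
    _ ≤ _ := by
        refine add_le_add ((srrw_L1_triangle h hg2m hg2i n).trans
          (mul_le_mul_of_nonneg_left hg2s (by positivity))) (L1.trans ?_)
        gcongr
        exact L2.trans (mul_le_mul_of_nonneg_right hg1s hH)

lemma srrw_L1 (h : IsSRRW P α μ X) (hα : α ≤ 1/2) {φ : E → ℝ} (hφm : Measurable φ)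
    (hφ0 : ∫ x, φ x ∂μ = 0) {s : ℝ} (hs1 : 1 < s) (hs2 : s < 2)
    (hmom : Integrable (fun x => |φ x| ^ s) μ) {γ : ℝ} (hγ : 1 / s < γ) :
    ∃ C : ℝ, 0 ≤ C ∧ ∀ n : ℕ, 1 ≤ n → ∫ ω, |srrwW X φ n ω| ∂P ≤ C * (n:ℝ)^γ := by
  set m := ∫ x, |φ x|^s ∂μ with hm
  have hm0 : 0 ≤ m := integral_nonneg fun x => Real.rpow_nonneg (abs_nonneg _) _
  set δ := γ - 1/s with hδ
  have hδ0 : 0 < δ := by linarith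
  refine ⟨2 * m + 1/2 + m / 2 * (1 + 1/δ), by positivity, fun n hn => ?_⟩
  have hn1 : (1:ℝ) ≤ n := by exact_mod_cast hn
  have hn0 : (0:ℝ) < n := by linarith
  set K := (n:ℝ)^(1/s) with hKdef
  have hK : 0 < K := Real.rpow_pos_of_pos hn0 _
  have key := srrw_L1_K h hα hφm hφ0 hs1 hs2 hmom n hK
  rw [← hm] at key
  have e1 : (n:ℝ) * K^(1-s) = K := by
    have : (n:ℝ) = K^s := by
      rw [hKdef, ← Real.rpow_mul hn0.le, one_div_mul_cancel (by linarith), Real.rpow_one]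
    conv_lhs => rw [this]
    rw [← Real.rpow_add hK]; simp
  have e2 : (n:ℝ) * K^(2-s) = K * K := by
    have : K^(2-s) = K^(1-s) * K := by
      rw [show (2 - s) = (1 - s) + 1 by ring, Real.rpow_add hK, Real.rpow_one]
    rw [this, ← mul_assoc, e1]
  set H := (harmonic n : ℝ) with hH
  have hlog : H ≤ 1 + (n:ℝ)^δ / δ :=
    (harmonic_le_one_add_log n).trans (by linarith [Real.log_le_rpow_div hn0.le hδ0])
  have e3 : n * (2 * (K^(1-s) * m)) + ((K^(2-s) * m) * (n * H) / K + K) / 2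
      = K * (2 * m + 1/2 + m/2 * H) := by
    have a1 : n * (2 * (K^(1-s) * m)) = 2 * m * (n * K^(1-s)) := by ring
    have a2 : (K^(2-s) * m) * (n * H) / K = (n * K^(2-s)) * (m * H) / K := by ring
    rw [a1, a2, e1, e2]
    field_simp
    ring
  rw [e3] at key
  have hnδ : 1 ≤ (n:ℝ)^δ := Real.one_le_rpow hn1 hδ0.le
  have e4 : (n:ℝ)^γ = K * (n:ℝ)^δ := by
    rw [hKdef, ← Real.rpow_add hn0]; congr 1; rw [hδ]; ring
  refine key.trans ?_
  rw [e4, ← mul_assoc, mul_comm _ K, mul_assoc]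
  refine mul_le_mul_of_nonneg_left ?_ hK.le
  have : m/2*H ≤ m/2 * ((1 + 1/δ) * (n:ℝ)^δ) := by
    refine mul_le_mul_of_nonneg_left (hlog.trans ?_) (by positivity)
    rw [add_mul, one_div_mul_eq_div]; linarith
  nlinarith

lemma srrw_b_bound {α β x : ℝ} (hα0 : 0 ≤ α) (hα : α ≤ 1) (hβ0 : 0 ≤ β) (hβ1 : β ≤ 1)
    (hx : 0 < x) :
    |(x+1)^(-β) * (1 + α / x) - x^(-β)| ≤ x^(-β) * x⁻¹ := by
  have hp : 0 < x^(-β) := Real.rpow_pos_of_pos hx _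
  have h1 : (x+1)^(-β) ≤ x^(-β) :=
    Real.rpow_le_rpow_of_nonpos hx (by linarith) (by linarith)
  have h2 : x^(-β) * (x / (x+1)) ≤ (x+1)^(-β) := by
    have e : (x+1)^(-β) = x^(-β) * (x/(x+1))^β := by
      rw [Real.div_rpow hx.le (by linarith), Real.rpow_neg hx.le, Real.rpow_neg (by linarith)]
      have := Real.rpow_pos_of_pos hx β
      field_simp
    rw [e]
    refine mul_le_mul_of_nonneg_left ?_ hp.le
    have hy1 : x/(x+1) ≤ 1 := by rw [div_le_one (by linarith)]; linarith
    calc x/(x+1) = (x/(x+1))^(1:ℝ) := (Real.rpow_one _).symm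
      _ ≤ _ := Real.rpow_le_rpow_of_exponent_ge (by positivity) hy1 hβ1
  have hax : α / x ≤ x⁻¹ := by rw [← one_div]; gcongr
  have hax0 : 0 ≤ α / x := by positivity
  rw [abs_le]
  constructor
  · have h3 : x^(-β) * (x/(x+1)) ≤ (x+1)^(-β) * (1 + α / x) := by
      refine h2.trans (le_mul_of_one_le_right (by positivity) (by linarith))
    have h4 : x / (x+1) = 1 - (x+1)⁻¹ := by field_simp; ring
    have h5 : (x+1)⁻¹ ≤ x⁻¹ := by gcongr; linarith
    rw [h4] at h3
    nlinarith [mul_le_mul_of_nonneg_left h5 hp.le]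
  · have h3 : (x+1)^(-β) * (1 + α / x) ≤ x^(-β) * (1 + x⁻¹) :=
      mul_le_mul h1 (by linarith) (by linarith) hp.le
    nlinarith

lemma srrw_main (h : IsSRRW P α μ X) (hα : α ≤ 1/2) {φ : E → ℝ} (hφm : Measurable φ)
    (hφ0 : ∫ x, φ x ∂μ = 0) {s : ℝ} (hs1 : 1 < s) (hs2 : s < 2)
    (hmom : Integrable (fun x => |φ x| ^ s) μ) {β : ℝ} (hβ : 1 / s < β) (hβ1 : β ≤ 1) :
    (∀ᵐ ω ∂P, Tendsto (fun n : ℕ => (n:ℝ)^(-β) * srrwW X φ n ω) atTop (𝓝 0)) ∧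
    Tendsto (fun n : ℕ => ∫ ω, (n:ℝ)^(-β) * |srrwW X φ n ω| ∂P) atTop (𝓝 0) := by
  have := h.probP
  have := h.probμ
  have hα0 := h.alpha_nonneg
  have hφ := srrw_int_of_mom hφm hs1 hmom
  obtain ⟨γ, hγ1, hγ2⟩ := exists_between hβ
  obtain ⟨C, hC0, hC⟩ := srrw_L1 h hα hφm hφ0 hs1 hs2 hmom hγ1
  have hβ0 : 0 < β := lt_trans (by positivity) hβ
  have hWi := srrwW_int h hφ
  have hbd : ∀ n : ℕ, 1 ≤ n → ∫ ω, (n:ℝ)^(-β) * |srrwW X φ n ω| ∂P ≤ C * (n:ℝ)^(-(β - γ)) := by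
    intro n hn
    have hn0 : (0:ℝ) < n := by exact_mod_cast hn
    rw [integral_const_mul, show -(β-γ) = -β + γ by ring, Real.rpow_add hn0]
    calc _ ≤ (n:ℝ)^(-β) * (C * (n:ℝ)^γ) :=
          mul_le_mul_of_nonneg_left (hC n hn) (by positivity)
      _ = _ := by ring
  have hL1 : Tendsto (fun n : ℕ => ∫ ω, (n:ℝ)^(-β) * |srrwW X φ n ω| ∂P) atTop (𝓝 0) := by
    have lim : Tendsto (fun n : ℕ => C * (n:ℝ)^(-(β - γ))) atTop (𝓝 0) := by
      simpa using ((tendsto_rpow_neg_atTop (sub_pos.2 hγ2)).comp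
        tendsto_natCast_atTop_atTop).const_mul C
    refine tendsto_of_tendsto_of_tendsto_of_le_of_le' tendsto_const_nhds lim ?_ ?_
    · exact Eventually.of_forall fun n => integral_nonneg fun ω => by positivity
    · exact (eventually_ge_atTop 1).mono hbd
  refine ⟨?_, hL1⟩
  -- the shifted process
  set t : ℕ → Ω → ℝ := fun n ω => ((n:ℝ)+1)^(-β) * srrwW X φ (n+1) ω with ht
  set b : ℕ → ℝ := fun k => ((k:ℝ)+1+1)^(-β) * (1 + α / ((k:ℝ)+1)) - ((k:ℝ)+1)^(-β) with hb
  set r : ℕ → Ω → ℝ := fun k ω => b k * srrwW X φ (k+1) ω with hr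
  set N : ℕ → Ω → ℝ := fun n ω => t n ω - ∑ k ∈ Finset.range n, r k ω with hN
  have hti : ∀ n, Integrable (t n) P := fun n => (hWi (n+1)).const_mul _
  have hri : ∀ n, Integrable (r n) P := fun n => (hWi (n+1)).const_mul _
  have hNi : ∀ n, Integrable (N n) P := fun n =>
    (hti n).sub (integrable_finsetSum _ fun k _ => hri k)
  have htb : ∀ n, ∫ ω, |t n ω| ∂P ≤ C := by
    intro n
    have := hbd (n+1) (by omega)
    push_cast at this
    have e : ∀ ω, |t n ω| = ((n:ℝ)+1)^(-β) * |srrwW X φ (n+1) ω| := by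
      intro ω
      rw [ht, abs_mul, abs_of_nonneg (by positivity)]
    simp_rw [e]
    refine this.trans (mul_le_of_le_one_right hC0 ?_)
    exact Real.rpow_le_one_of_one_le_of_nonpos (by linarith [(n.cast_nonneg : (0:ℝ) ≤ n)])
      (by linarith)
  set q : ℕ → ℝ := fun k => C * ((k:ℝ)+1)^(-(1 + (β - γ))) with hq
  have hqs : Summable q := by
    refine Summable.mul_left _ ?_
    have : Summable (fun k : ℕ => (k:ℝ)^(-(1 + (β - γ)))) :=
      Real.summable_nat_rpow.2 (by linarith)
    simpa using (summable_nat_add_iff 1).2 this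
  have hrb : ∀ k, ∫ ω, |r k ω| ∂P ≤ q k := by
    intro k
    have hk : (0:ℝ) < (k:ℝ) + 1 := by positivity
    have hC' := hC (k+1) (by omega)
    push_cast at hC'
    simp_rw [hr, abs_mul]
    rw [integral_const_mul]
    calc |b k| * ∫ ω, |srrwW X φ (k+1) ω| ∂P
        ≤ (((k:ℝ)+1)^(-β) * ((k:ℝ)+1)⁻¹) * (C * ((k:ℝ)+1)^γ) :=
          mul_le_mul (srrw_b_bound hα0 (by linarith) hβ0.le hβ1 hk) hC'
            (integral_nonneg fun ω => abs_nonneg _) (by positivity)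
      _ = q k := by
          rw [hq, ← Real.rpow_neg_one]
          simp only
          rw [show -(1 + (β-γ)) = -β + -1 + γ by ring, Real.rpow_add hk, Real.rpow_add hk]
          ring
  -- filtration and martingale property
  let ℱ : Filtration ℕ mΩ :=
    { seq := fun n => srrwFiltration X (n+1)
      mono' := fun m n hmn => srrwFiltration_mono (by omega)
      le' := fun n => srrwFiltration_le h (n+1) }
  have hWF : ∀ m n, m ≤ n + 1 → StronglyMeasurable[ℱ n] (srrwW X φ m) := by
    intro m n hmn
    exact ((srrwW_meas φ hφm m).mono (srrwFiltration_mono hmn) le_rfl).stronglyMeasurable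
  have hsumF : ∀ m n, m ≤ n + 1 →
      StronglyMeasurable[ℱ n] (fun ω => ∑ k ∈ Finset.range m, r k ω) := by
    intro m n hmn
    refine Finset.stronglyMeasurable_fun_sum _ fun k hk => ?_
    have hk' := Finset.mem_range.1 hk
    exact (hWF (k+1) n (by omega)).const_mul _
  have hmart : Martingale N ℱ P := by
    refine martingale_nat ?_ hNi ?_
    · intro n
      exact ((hWF (n+1) n le_rfl).const_mul _).sub (hsumF n n (by omega))
    · intro n
      set G : Ω → ℝ := fun ω => ((n:ℝ)+1+1)^(-β) * srrwW X φ (n+1) ω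
        - ∑ k ∈ Finset.range (n+1), r k ω with hG
      have hGm : StronglyMeasurable[ℱ n] G :=
        ((hWF (n+1) n le_rfl).const_mul _).sub (hsumF (n+1) n le_rfl)
      have hGi : Integrable G P := ((hWi (n+1)).const_mul _).sub
        (integrable_finsetSum _ fun k _ => hri k)
      have hXi : Integrable (fun ω => φ (X (n+1+1) ω)) P := srrw_int h (by omega) hφ
      have e : N (n+1) = G + (((n:ℝ)+1+1)^(-β)) • (fun ω => φ (X (n+1+1) ω)) := by
        funext ω
        simp only [hN, hG, ht, Pi.add_apply, Pi.smul_apply, smul_eq_mul, srrwW_succ φ (n+1)]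
        push_cast
        ring
      rw [e]
      have c1 := condExp_add hGi (hXi.smul (((n:ℝ)+1+1)^(-β))) (ℱ n)
      have c2 := condExp_smul (μ := P) (((n:ℝ)+1+1)^(-β)) (fun ω => φ (X (n+1+1) ω)) (ℱ n)
      have c3 := srrw_condExp h (n := n+1) (by omega) hφm hφ hφ0
      have c3' : P[(fun ω => φ (X (n+1+1) ω)) | ℱ n] =ᵐ[P]
        fun ω => (α / ((n+1 : ℕ):ℝ)) * srrwW X φ (n+1) ω := c3
      rw [condExp_of_stronglyMeasurable (ℱ.le n) hGm hGi] at c1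
      filter_upwards [c1, c2, c3'] with ω h1 h2 h3
      rw [h1, Pi.add_apply, h2, Pi.smul_apply, h3]
      simp only [hN, hG, ht, smul_eq_mul, Finset.sum_range_succ]
      simp only [hr, hb]
      push_cast
      ring
  have hnormint : ∀ {f : Ω → ℝ}, Integrable f P →
      eLpNorm f 1 P = ENNReal.ofReal (∫ ω, |f ω| ∂P) := by
    intro f hf
    rw [eLpNorm_one_eq_lintegral_enorm, ← ofReal_integral_norm_eq_lintegral_enorm hf]
    simp only [Real.norm_eq_abs]
  have hNb : ∀ n, eLpNorm (N n) 1 P ≤ ((C + ∑' k, q k).toNNReal : ℝ≥0∞) := by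
    intro n
    rw [hnormint (hNi n)]
    refine ENNReal.ofReal_le_ofReal ?_
    calc ∫ ω, |N n ω| ∂P ≤ ∫ ω, (|t n ω| + ∑ k ∈ Finset.range n, |r k ω|) ∂P := by
          refine integral_mono (hNi n).abs ((hti n).abs.add
            (integrable_finsetSum _ fun k _ => (hri k).abs)) fun ω => ?_
          exact (abs_sub _ _).trans (add_le_add le_rfl (Finset.abs_sum_le_sum_abs _ _))
      _ = ∫ ω, |t n ω| ∂P + ∑ k ∈ Finset.range n, ∫ ω, |r k ω| ∂P := by
          rw [integral_add (hti n).abs (integrable_finsetSum _ fun k _ => (hri k).abs),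
            integral_finsetSum _ fun k _ => (hri k).abs]
      _ ≤ C + ∑ k ∈ Finset.range n, q k :=
          add_le_add (htb n) (Finset.sum_le_sum fun k _ => hrb k)
      _ ≤ C + ∑' k, q k := by
          gcongr
          exact hqs.sum_le_tsum _ fun k _ => by positivity
  have hconvN := hmart.submartingale.exists_ae_tendsto_of_bdd hNb
  have hsum : ∀ᵐ ω ∂P, Summable (fun k => ‖r k ω‖) := by
    refine summable_norm_of_tsum_eLpNorm_ne_top le_rfl (fun k => (hri k).aestronglyMeasurable) ?_
    simp_rw [fun k => hnormint (hri k)]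
    refine Summable.tsum_ofReal_ne_top (Summable.of_nonneg_of_le
      (fun k => integral_nonneg fun ω => abs_nonneg _) hrb hqs)
  have hmeas0 : TendstoInMeasure P t atTop (fun _ => (0:ℝ)) := by
    refine tendstoInMeasure_of_tendsto_eLpNorm (p := 1) one_ne_zero
      (fun n => (hti n).aestronglyMeasurable) aestronglyMeasurable_const ?_
    have e : ∀ n, eLpNorm (t n - fun _ => (0:ℝ)) 1 P = ENNReal.ofReal (∫ ω, |t n ω| ∂P) := by
      intro n
      rw [← hnormint (hti n)]
      congr 1
      funext ω
      simp
    simp_rw [e]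
    rw [← ENNReal.ofReal_zero]
    refine (ENNReal.continuous_ofReal.tendsto 0).comp ?_
    have := (tendsto_add_atTop_iff_nat 1).2 hL1
    refine this.congr fun n => ?_
    refine integral_congr_ae (ae_of_all _ fun ω => ?_)
    simp only [ht, abs_mul]
    push_cast
    rw [abs_of_nonneg (by positivity : (0:ℝ) ≤ ((n:ℝ)+1)^(-β))]
  obtain ⟨ns, hns, hns0⟩ := hmeas0.exists_seq_tendsto_ae
  filter_upwards [hconvN, hsum, hns0] with ω h1 h2 h3
  obtain ⟨c, hc⟩ := h1
  have h4 : Tendsto (fun n => t n ω) atTop (𝓝 (c + ∑' k, r k ω)) := by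
    have := hc.add (h2.of_norm.hasSum.tendsto_sum_nat)
    refine this.congr fun n => ?_
    simp [hN]
  have h5 : c + ∑' k, r k ω = 0 :=
    tendsto_nhds_unique (h4.comp hns.tendsto_atTop) h3
  rw [h5] at h4
  refine (tendsto_add_atTop_iff_nat 1).1 (h4.congr fun n => ?_)
  simp [ht]

end SRRWAux

theorem stmt16 {Ω : Type*} [MeasurableSpace Ω] {d : ℕ}
    (P : Measure Ω) (α : ℝ) (μ : Measure (EuclideanSpace ℝ (Fin d)))
    (X : ℕ → Ω → EuclideanSpace ℝ (Fin d))
    (hsrrw : IsSRRW P α μ X) (hα : α ≤ 1 / 2)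
    (hmean : ∫ x, x ∂μ = 0)
    (s : ℝ) (hs1 : 1 < s) (hs2 : s < 2)
    (hmom : Integrable (fun x => ‖x‖ ^ s) μ)
    (ν : ℝ) (hν0 : 0 < ν) (hν1 : ν < 1 - 1 / s) :
    (∀ᵐ ω ∂P, Tendsto
        (fun n : ℕ => (n : ℝ) ^ ν *
          ‖(1 / (n:ℝ)) • srrwSum X n ω - ∫ x, x ∂μ‖)
        atTop (𝓝 0))
    ∧ Tendsto
        (fun n : ℕ => ∫ ω, (n : ℝ) ^ ν *
          ‖(1 / (n:ℝ)) • srrwSum X n ω - ∫ x, x ∂μ‖ ∂P)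
        atTop (𝓝 0) := by
  have := hsrrw.probP
  have := hsrrw.probμ
  set β := 1 - ν with hβ
  have hidi : Integrable (fun x : EuclideanSpace ℝ (Fin d) => x) μ := by
    have h1 : Integrable (fun x : EuclideanSpace ℝ (Fin d) => ‖x‖) μ := by
      refine srrw_int_of_mom measurable_norm hs1 ?_
      simpa using hmom
    exact (integrable_norm_iff measurable_id.aestronglyMeasurable).1 h1
  have hcm : ∀ i : Fin d, Measurable (fun x : EuclideanSpace ℝ (Fin d) => x i) := fun i =>
    (EuclideanSpace.proj (𝕜 := ℝ) i).continuous.measurable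
  have hcabs : ∀ (i : Fin d) (x : EuclideanSpace ℝ (Fin d)), |x i| ≤ ‖x‖ := fun i x => by
    simpa using PiLp.norm_apply_le x i
  have hc0 : ∀ i : Fin d, ∫ x, x i ∂μ = 0 := by
    intro i
    have := (EuclideanSpace.proj (𝕜 := ℝ) i).integral_comp_comm hidi
    rw [hmean] at this
    simpa using this
  have hcmom : ∀ i : Fin d, Integrable (fun x => |x i| ^ s) μ := by
    intro i
    refine hmom.mono' ((hcm i).abs.pow_const s).aestronglyMeasurable (ae_of_all _ fun x => ?_)
    rw [Real.norm_eq_abs, abs_of_nonneg (Real.rpow_nonneg (abs_nonneg _) _)]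
    exact Real.rpow_le_rpow (abs_nonneg _) (hcabs i x) (by linarith)
  have main := fun i : Fin d => srrw_main hsrrw hα (hcm i) (hc0 i) hs1 hs2 (hcmom i)
    (β := β) (by rw [hβ]; linarith) (by rw [hβ]; linarith)
  have hci : ∀ i : Fin d, Integrable (fun x : EuclideanSpace ℝ (Fin d) => x i) μ := fun i =>
    srrw_int_of_mom (hcm i) hs1 (hcmom i)
  have hnorm : ∀ x : EuclideanSpace ℝ (Fin d), ‖x‖ ≤ ∑ i, |x i| := by
    intro x
    rw [EuclideanSpace.norm_eq]
    refine Real.sqrt_le_iff.2 ⟨Finset.sum_nonneg fun i _ => abs_nonneg _, ?_⟩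
    simp only [Real.norm_eq_abs]
    exact Finset.sum_sq_le_sq_sum_of_nonneg fun i _ => abs_nonneg _
  have hcoord : ∀ n ω (i : Fin d), (srrwSum X n ω) i = srrwW X (fun x => x i) n ω := by
    intro n ω i
    simp [srrwSum, srrwW]
  have hle : ∀ (n : ℕ), 1 ≤ n → ∀ ω, (n : ℝ) ^ ν * ‖(1 / (n:ℝ)) • srrwSum X n ω - ∫ x, x ∂μ‖ ≤
      ∑ i : Fin d, (n:ℝ)^(-β) * |srrwW X (fun x => x i) n ω| := by
    intro n hn ω
    have hn0 : (0:ℝ) < n := by exact_mod_cast hn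
    rw [hmean, sub_zero, norm_smul, ← Finset.mul_sum, ← mul_assoc]
    have e : (n:ℝ)^ν * ‖1 / (n:ℝ)‖ = (n:ℝ)^(-β) := by
      rw [Real.norm_eq_abs, abs_of_nonneg (by positivity), show -β = ν - 1 by rw [hβ]; ring,
        Real.rpow_sub hn0, Real.rpow_one]
      ring
    rw [e]
    refine mul_le_mul_of_nonneg_left ((hnorm _).trans (le_of_eq ?_)) (by positivity)
    simp only [hcoord]
  constructor
  · filter_upwards [ae_all_iff.2 fun i => (main i).1] with ω hω
    have lim : Tendsto (fun n : ℕ => ∑ i : Fin d, (n:ℝ)^(-β) * |srrwW X (fun x => x i) n ω|)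
        atTop (𝓝 0) := by
      have := tendsto_finsetSum Finset.univ (fun i _ => (hω i).abs)
      simp only [abs_zero, Finset.sum_const_zero] at this
      refine this.congr fun n => Finset.sum_congr rfl fun i _ => ?_
      rw [abs_mul, abs_of_nonneg (by positivity : (0:ℝ) ≤ (n:ℝ)^(-β))]
    refine tendsto_of_tendsto_of_tendsto_of_le_of_le' tendsto_const_nhds lim
      (Eventually.of_forall fun n => by positivity)
      ((eventually_ge_atTop 1).mono fun n hn => hle n hn ω)
  · have hint : ∀ (n : ℕ) (i : Fin d),
        Integrable (fun ω => (n:ℝ)^(-β) * |srrwW X (fun x => x i) n ω|) P := fun n i =>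
      (srrwW_int hsrrw (hci i) n).abs.const_mul _
    have lim : Tendsto (fun n : ℕ => ∑ i : Fin d, ∫ ω, (n:ℝ)^(-β) *
        |srrwW X (fun x => x i) n ω| ∂P) atTop (𝓝 0) := by
      have := tendsto_finsetSum Finset.univ (fun i _ => (main i).2)
      simpa only [Finset.sum_const_zero] using this
    refine tendsto_of_tendsto_of_tendsto_of_le_of_le' tendsto_const_nhds lim
      (Eventually.of_forall fun n => integral_nonneg fun ω => by positivity)
      ((eventually_ge_atTop 1).mono fun n hn => ?_)
    rw [← integral_finsetSum _ fun i _ => hint n i]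
    exact integral_mono_of_nonneg (ae_of_all _ fun ω => by positivity)
      (integrable_finsetSum _ fun i _ => hint n i) (ae_of_all _ fun ω => hle n hn ω)

end
end
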